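/- arXiv:1903.10037 — 3 statements merged into one kernel-verified Lean document; each statement's English description precedes it below -/
import Mathlib

section
/- For ν-almost every β ∈ ℝ^V the following hold: (a) for every nonempty finite U ⊆ V the principal submatrix (H_β)_{U,U} is positive definite; (b) for all i,j ∈ V, the sequence n ↦ ((H_β)_{V_n,V_n})^{-1}(i,j), defined for all n large enough that i,j ∈ V_n, is nondecreasing in n and converges to a finite limit Ĝ(i,j). -/
open MeasureTheory Matrix

noncomputable section

/-- The Schrödinger operator `H_β = 2·diag(β) − W`. -/
def Hmat {V : Type*} [Fintype V] [DecidableEq V] (W : Matrix V V ℝ) (β : V → ℝ) :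
    Matrix V V ℝ :=
  2 • Matrix.diagonal β - W

/-- Density of the measure `ν_V^{W,η}` with respect to Lebesgue measure. -/
def nuDens {V : Type*} [Fintype V] [DecidableEq V] (W : Matrix V V ℝ) (η : V → ℝ)
    (β : V → ℝ) : ENNReal :=
  Set.indicator {β : V → ℝ | (Hmat W β).PosDef}
    (fun β => ENNReal.ofReal
      ((2 / Real.pi) ^ ((Fintype.card V : ℝ) / 2) *
        Real.exp (-(1 / 2) * ((1 : V → ℝ) ⬝ᵥ (Hmat W β).mulVec 1
            + η ⬝ᵥ (Hmat W β)⁻¹.mulVec η) + η ⬝ᵥ (1 : V → ℝ)) /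
        Real.sqrt (Hmat W β).det)) β

/-- The measure `ν_V^{W,η}`. -/
def nuMeas {V : Type*} [Fintype V] [DecidableEq V] (W : Matrix V V ℝ) (η : V → ℝ) :
    Measure (V → ℝ) :=
  volume.withDensity (nuDens W η)

/-- The graph on `V` with an edge `{i,j}` whenever `W i j > 0`. -/
def graphOf {V : Type*} (W : Matrix V V ℝ) : SimpleGraph V :=
  SimpleGraph.fromRel (fun i j => 0 < W i j)


/-- The compatibility property: for every nonempty finite `U ⊆ V`, the pushforward of `ν`
under the restriction map is `ν_U^{W_{U,U}, η_U}` with `η_U i = Σ_{j∉U} W i j`. -/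
def RestrictionProp {V : Type*} [DecidableEq V] (W : V → V → ℝ)
    (ν : Measure (V → ℝ)) : Prop :=
  ∀ U : Finset V, U.Nonempty →
    Measure.map (fun (β : V → ℝ) (i : ↥U) => β i.1) ν
      = nuMeas (Matrix.of fun i j : ↥U => W i.1 j.1)
          (fun i : ↥U => ∑' j : V, if j ∈ U then 0 else W i.1 j)

/-- The restriction of `H_β = 2 diag(β) − W` to a finite subset `U` of `V`. -/
def HmatRestr {V : Type*} [DecidableEq V] (W : V → V → ℝ) (β : V → ℝ) (U : Finset V) :
    Matrix ↥U ↥U ℝ :=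
  Hmat (Matrix.of fun i j : ↥U => W i.1 j.1) (fun i : ↥U => β i.1)

/-- The sequence `n ↦ ((H_β)_{V_n,V_n})^{-1}(i,j)`, with junk value `0` when `i ∉ V_n` or
`j ∉ V_n`. -/
def GhatSeq {V : Type*} [DecidableEq V] (W : V → V → ℝ) (Vseq : ℕ → Finset V)
    (β : V → ℝ) (i j : V) (n : ℕ) : ℝ :=
  if h : i ∈ Vseq n ∧ j ∈ Vseq n then (HmatRestr W β (Vseq n))⁻¹ ⟨i, h.1⟩ ⟨j, h.2⟩ else 0


lemma aux_maxprin {A : Type*} [Fintype A] [DecidableEq A] (H : Matrix A A ℝ) (hH : H.PosDef)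
    (hoff : ∀ i j, i ≠ j → H i j ≤ 0) (x : A → ℝ) (hx : ∀ i, 0 ≤ (H *ᵥ x) i) (i : A) :
    0 ≤ x i := by
  set m : A → ℝ := fun i => max (-x i) 0 with hm
  have h1 : 0 ≤ m ⬝ᵥ (H *ᵥ x) :=
    Finset.sum_nonneg fun i _ => mul_nonneg (le_max_right _ _) (hx i)
  have h2 : m ⬝ᵥ (H *ᵥ (x + m)) ≤ 0 := by
    simp only [dotProduct, mulVec, Finset.mul_sum]
    refine Finset.sum_nonpos fun i _ => Finset.sum_nonpos fun j _ => ?_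
    have hp : 0 ≤ x j + m j := by simp only [hm]; linarith [le_max_left (-x j) 0]
    have hmi : 0 ≤ m i := le_max_right _ _
    by_cases hij : i = j
    · subst hij
      have : m i * (x i + m i) = 0 := by
        simp only [hm]
        rcases max_cases (-x i) 0 with h | h <;> rw [h.1] <;> ring
      simp only [Pi.add_apply]
      have e : m i * (H i i * (x i + m i)) = H i i * (m i * (x i + m i)) := by ring
      rw [e, this]; simp
    · simp only [Pi.add_apply]
      have := mul_nonneg hmi hp
      have h3 := hoff i j hij
      nlinarith [mul_nonneg this (neg_nonneg.2 h3)]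
  have h3 : m ⬝ᵥ (H *ᵥ m) ≤ 0 := by
    rw [mulVec_add, dotProduct_add] at h2; linarith
  have h4 : m = 0 := by
    by_contra hne
    have := hH.dotProduct_mulVec_pos hne
    simp only [star_trivial] at this
    linarith
  have := congrFun h4 i
  simp only [hm, Pi.zero_apply] at this
  linarith [le_max_left (-x i) 0]

lemma aux_Hmat_apply {A : Type*} [Fintype A] [DecidableEq A] (W : Matrix A A ℝ) (β : A → ℝ)
    (i j : A) : Hmat W β i j = (if i = j then 2 * β i else 0) - W i j := by
  rw [Hmat, Matrix.sub_apply, Matrix.smul_apply, diagonal_apply]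
  split_ifs <;> simp

lemma aux_Hmat_mulVec {A : Type*} [Fintype A] [DecidableEq A] (W : Matrix A A ℝ) (β x : A → ℝ)
    (i : A) : (Hmat W β *ᵥ x) i = 2 * β i * x i - ∑ j, W i j * x j := by
  simp only [mulVec, dotProduct, aux_Hmat_apply, sub_mul, Finset.sum_sub_distrib, ite_mul, zero_mul]
  simp

lemma aux_mul_inv {A : Type*} [Fintype A] [DecidableEq A] (H : Matrix A A ℝ) (hH : H.PosDef)
    (x : A → ℝ) : H *ᵥ (H⁻¹ *ᵥ x) = x := by
  rw [mulVec_mulVec, mul_nonsing_inv _ (isUnit_iff_ne_zero.2 hH.det_pos.ne'), one_mulVec]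

lemma aux_inv_mul {A : Type*} [Fintype A] [DecidableEq A] (H : Matrix A A ℝ) (hH : H.PosDef)
    (x : A → ℝ) : H⁻¹ *ᵥ (H *ᵥ x) = x := by
  rw [mulVec_mulVec, nonsing_inv_mul _ (isUnit_iff_ne_zero.2 hH.det_pos.ne'), one_mulVec]

lemma aux_offdiag {A : Type*} [Fintype A] [DecidableEq A] (G : Matrix A A ℝ) (hG : G.PosSemidef)
    (i j : A) : G i j ≤ G i i + G j j := by
  by_cases hij : i = j
  · subst hij; linarith [hG.diag_nonneg (i := i)]
  have h := hG.dotProduct_mulVec_nonneg (Pi.single i 1 - Pi.single j 1)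
  have hs : G j i = G i j := by
    have := hG.isHermitian.apply i j; simpa using this
  simp [mulVec_sub, sub_dotProduct, dotProduct_sub, hs] at h
  linarith [hG.diag_nonneg (i := i), hG.diag_nonneg (i := j)]

lemma aux_mono {V : Type*} [DecidableEq V] (W : V → V → ℝ) (hnn : ∀ i j, 0 ≤ W i j)
    (β : V → ℝ) (U U' : Finset V) (hUU : U ⊆ U')
    (hU : (HmatRestr W β U).PosDef) (hU' : (HmatRestr W β U').PosDef)
    (i j : V) (hi : i ∈ U) (hj : j ∈ U) :
    (HmatRestr W β U)⁻¹ ⟨i, hi⟩ ⟨j, hj⟩ ≤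
      (HmatRestr W β U')⁻¹ ⟨i, hUU hi⟩ ⟨j, hUU hj⟩ := by
  have hoff : ∀ (U : Finset V) (i j : U), i ≠ j → HmatRestr W β U i j ≤ 0 := by
    intro U i j hij
    simp [HmatRestr, aux_Hmat_apply, hij, hnn]
  set g := (HmatRestr W β U)⁻¹ *ᵥ (Pi.single ⟨j, hj⟩ 1) with hg
  set g' := (HmatRestr W β U')⁻¹ *ᵥ (Pi.single ⟨j, hUU hj⟩ 1) with hg'
  have hHg : HmatRestr W β U *ᵥ g = Pi.single ⟨j, hj⟩ 1 := aux_mul_inv _ hU _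
  have hHg' : HmatRestr W β U' *ᵥ g' = Pi.single ⟨j, hUU hj⟩ 1 := aux_mul_inv _ hU' _
  have hg'0 : ∀ k, 0 ≤ g' k := by
    refine aux_maxprin _ hU' (hoff U') _ fun k => ?_
    rw [hHg']
    by_cases h : k = ⟨j, hUU hj⟩ <;> simp [h]
  let r : U → ℝ := fun k => g' ⟨k.1, hUU k.2⟩
  have key : ∀ k, 0 ≤ (r - g) k := by
    refine aux_maxprin _ hU (hoff U) _ fun k => ?_
    rw [mulVec_sub, hHg]
    have h1 := congrFun hHg' ⟨k.1, hUU k.2⟩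
    simp only [HmatRestr] at h1 ⊢
    rw [aux_Hmat_mulVec] at h1
    rw [Pi.sub_apply, aux_Hmat_mulVec]
    simp only [of_apply] at h1 ⊢
    have hs : (Pi.single (⟨j, hUU hj⟩ : U') (1:ℝ) : U' → ℝ) ⟨k.1, hUU k.2⟩
        = (Pi.single (⟨j, hj⟩ : U) (1:ℝ) : U → ℝ) k := by
      by_cases h : k = ⟨j, hj⟩
      · subst h; simp
      · have h' : (⟨k.1, hUU k.2⟩ : U') ≠ ⟨j, hUU hj⟩ := by
          intro hh; apply h; ext; simpa using hh
        rw [Pi.single_eq_of_ne h, Pi.single_eq_of_ne h']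
    rw [hs] at h1
    rw [← h1]
    have hsum : ∑ l : U, W k.1 l.1 * r l ≤ ∑ l : U', W k.1 l.1 * g' l := by
      have e : ∑ l : U, W k.1 l.1 * r l =
          ∑ l ∈ Finset.univ.map ⟨fun l : U => (⟨l.1, hUU l.2⟩ : U'),
            fun a b h => by ext; simpa using h⟩, W k.1 l.1 * g' l := by
        rw [Finset.sum_map]; rfl
      rw [e]
      exact Finset.sum_le_sum_of_subset_of_nonneg (Finset.subset_univ _)
        fun l _ _ => mul_nonneg (hnn _ _) (hg'0 l)
    have : r k = g' ⟨k.1, hUU k.2⟩ := rfl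
    rw [this]
    linarith
  have := key ⟨i, hi⟩
  simp only [Pi.sub_apply, r, hg, hg', mulVec_single_one, col_apply] at this
  linarith

lemma aux_variational {A : Type*} [Fintype A] [DecidableEq A] (H : Matrix A A ℝ) (hH : H.PosDef)
    (η x : A → ℝ) : 2 * (η ⬝ᵥ x) - x ⬝ᵥ (H *ᵥ x) ≤ η ⬝ᵥ (H⁻¹ *ᵥ η) := by
  have h := hH.posSemidef.dotProduct_mulVec_nonneg (x - H⁻¹ *ᵥ η)
  have hs : ∀ a b : A → ℝ, a ⬝ᵥ (H *ᵥ b) = b ⬝ᵥ (H *ᵥ a) := by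
    intro a b
    have ht : Hᵀ = H := by simpa using hH.isHermitian.eq
    rw [dotProduct_mulVec, ← mulVec_transpose, ht, dotProduct_comm]
  simp only [star_trivial, mulVec_sub, dotProduct_sub, sub_dotProduct, aux_mul_inv H hH] at h
  rw [hs (H⁻¹ *ᵥ η) x, aux_mul_inv H hH, dotProduct_comm x η, dotProduct_comm _ η] at h
  linarith


section block
variable {ι : Type*} [Fintype ι] [DecidableEq ι]

/-- The off-diagonal row. -/
def auxw (W : Matrix (Unit ⊕ ι) (Unit ⊕ ι) ℝ) (j : ι) : ℝ := W (Sum.inl ()) (Sum.inr j)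

/-- The Schur shift. -/
def auxc (W : Matrix (Unit ⊕ ι) (Unit ⊕ ι) ℝ) (β' : ι → ℝ) : ℝ :=
  auxw W ⬝ᵥ ((Hmat (W.submatrix Sum.inr Sum.inr) β')⁻¹ *ᵥ auxw W)

lemma aux_sub (W : Matrix (Unit ⊕ ι) (Unit ⊕ ι) ℝ) (β : Unit ⊕ ι → ℝ) :
    Hmat (W.submatrix Sum.inr Sum.inr) (β ∘ Sum.inr) = (Hmat W β).submatrix Sum.inr Sum.inr := by
  ext i j
  simp [aux_Hmat_apply]

lemma aux_subPD (W : Matrix (Unit ⊕ ι) (Unit ⊕ ι) ℝ) (β : Unit ⊕ ι → ℝ)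
    (hPD : (Hmat W β).PosDef) :
    (Hmat (W.submatrix Sum.inr Sum.inr) (β ∘ Sum.inr)).PosDef := by
  rw [aux_sub]; exact hPD.submatrix Sum.inr_injective

lemma aux_G (W : Matrix (Unit ⊕ ι) (Unit ⊕ ι) ℝ) (hW : ∀ a b, W a b = W b a)
    (h0 : W (Sum.inl ()) (Sum.inl ()) = 0) (β : Unit ⊕ ι → ℝ) (hPD : (Hmat W β).PosDef) :
    (2 * β (Sum.inl ()) - auxc W (β ∘ Sum.inr)) *
      (Hmat W β)⁻¹ (Sum.inl ()) (Sum.inl ()) = 1 := by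
  have hPD' := aux_subPD W β hPD
  set H' := Hmat (W.submatrix Sum.inr Sum.inr) (β ∘ Sum.inr) with hH'
  set z := H'⁻¹ *ᵥ auxw W with hz
  have hHz : H' *ᵥ z = auxw W := aux_mul_inv _ hPD' _
  set y := 2 * β (Sum.inl ()) - auxc W (β ∘ Sum.inr) with hy
  have hx : Hmat W β *ᵥ (Sum.elim (fun _ => 1) z) = y • Pi.single (Sum.inl ()) 1 := by
    ext a
    rw [aux_Hmat_mulVec]
    rcases a with ⟨⟩ | j
    · simp [h0, hy, auxc, ← hH', ← hz, dotProduct, auxw]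
    · have h1 := congrFun hHz j
      rw [hH', aux_Hmat_mulVec] at h1
      simp [auxw] at h1 ⊢
      rw [hW (Sum.inr j) (Sum.inl ())]
      linarith
  have h2 := congrArg (fun v => ((Hmat W β)⁻¹ *ᵥ v) (Sum.inl ())) hx
  simp only [aux_inv_mul _ hPD, mulVec_smul, mulVec_single_one] at h2
  simpa using h2.symm

lemma aux_det (W : Matrix (Unit ⊕ ι) (Unit ⊕ ι) ℝ) (hW : ∀ a b, W a b = W b a)
    (h0 : W (Sum.inl ()) (Sum.inl ()) = 0) (β : Unit ⊕ ι → ℝ) (hPD : (Hmat W β).PosDef) :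
    (Hmat W β).det = (Hmat (W.submatrix Sum.inr Sum.inr) (β ∘ Sum.inr)).det *
      (2 * β (Sum.inl ()) - auxc W (β ∘ Sum.inr)) := by
  have hPD' := aux_subPD W β hPD
  set H' := Hmat (W.submatrix Sum.inr Sum.inr) (β ∘ Sum.inr) with hH'
  have : Invertible H' := invertibleOfIsUnitDet _ (isUnit_iff_ne_zero.2 hPD'.det_pos.ne')
  have e : Hmat W β = fromBlocks (of fun _ _ : Unit => 2 * β (Sum.inl ()))
      (of fun (_ : Unit) j => - auxw W j) (of fun j (_ : Unit) => - auxw W j) H' := by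
    ext a b
    rcases a with ⟨⟩ | a <;> rcases b with ⟨⟩ | b <;> simp [aux_Hmat_apply, h0, auxw, hH']
    exact hW _ _
  rw [e, det_fromBlocks₂₂]
  congr 1
  simp [det_unique, auxc, ← hH', mul_apply, dotProduct, mulVec, Finset.mul_sum, Finset.sum_mul]
  rw [Finset.sum_comm]
  simp only [mul_assoc]

lemma aux_exponent (W : Matrix (Unit ⊕ ι) (Unit ⊕ ι) ℝ) (hW : ∀ a b, W a b = W b a)
    (h0 : W (Sum.inl ()) (Sum.inl ()) = 0) (η β : Unit ⊕ ι → ℝ) (hPD : (Hmat W β).PosDef)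
    (H' : Matrix ι ι ℝ) (hH' : H' = Hmat (W.submatrix Sum.inr Sum.inr) (β ∘ Sum.inr))
    (η' : ι → ℝ) (hη' : η' = fun j => η (Sum.inr j) + auxw W j) :
    -(1 / 2) * ((1 : Unit ⊕ ι → ℝ) ⬝ᵥ (Hmat W β).mulVec 1
            + η ⬝ᵥ (Hmat W β)⁻¹.mulVec η) + η ⬝ᵥ (1 : Unit ⊕ ι → ℝ) ≤
    -(1 / 2) * ((1 : ι → ℝ) ⬝ᵥ H'.mulVec 1
            + η' ⬝ᵥ H'⁻¹.mulVec η') + η' ⬝ᵥ (1 : ι → ℝ) := by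
  have hPD' := aux_subPD W β hPD
  rw [← hH'] at hPD'
  set z := H'⁻¹ *ᵥ η' with hz
  have hHz : H' *ᵥ z = η' := aux_mul_inv _ hPD' _
  have quad : ∀ v : ι → ℝ, (Sum.elim (fun _ : Unit => (1:ℝ)) v) ⬝ᵥ
      (Hmat W β *ᵥ (Sum.elim (fun _ : Unit => (1:ℝ)) v)) =
      2 * β (Sum.inl ()) - 2 * (auxw W ⬝ᵥ v) + v ⬝ᵥ (H' *ᵥ v) := by
    intro v
    have e1 : (Hmat W β *ᵥ (Sum.elim (fun _ : Unit => (1:ℝ)) v)) (Sum.inl ()) =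
        2 * β (Sum.inl ()) - auxw W ⬝ᵥ v := by
      rw [aux_Hmat_mulVec]; simp [h0, auxw, dotProduct]
    have e2 : ∀ j, (Hmat W β *ᵥ (Sum.elim (fun _ : Unit => (1:ℝ)) v)) (Sum.inr j) =
        (H' *ᵥ v) j - auxw W j := by
      intro j
      rw [aux_Hmat_mulVec, hH', aux_Hmat_mulVec]; simp [auxw, hW (Sum.inr j) (Sum.inl ())]; ring
    have e3 : v ⬝ᵥ (H' *ᵥ v) - v ⬝ᵥ auxw W = ∑ j, v j * ((H' *ᵥ v) j - auxw W j) := by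
      simp only [dotProduct, mul_sub, Finset.sum_sub_distrib]
    rw [dotProduct, Fintype.sum_sum_type]
    simp only [e1, e2, Sum.elim_inl, Sum.elim_inr, Finset.univ_unique, Finset.sum_singleton]
    rw [← e3, dotProduct_comm v (auxw W)]
    ring
  have hone : (1 : Unit ⊕ ι → ℝ) = Sum.elim (fun _ : Unit => (1:ℝ)) (1 : ι → ℝ) := by
    ext a; rcases a with a | a <;> simp
  have lin : ∀ v : ι → ℝ, η ⬝ᵥ (Sum.elim (fun _ : Unit => (1:ℝ)) v) =
      η (Sum.inl ()) + (fun j => η (Sum.inr j)) ⬝ᵥ v := by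
    intro v
    simp [dotProduct, Fintype.sum_sum_type]
  have lin' : ∀ v : ι → ℝ, η' ⬝ᵥ v = (fun j => η (Sum.inr j)) ⬝ᵥ v + auxw W ⬝ᵥ v := by
    intro v
    rw [← add_dotProduct, hη']; rfl
  have hv := aux_variational _ hPD η (Sum.elim (fun _ : Unit => (1:ℝ)) z)
  rw [quad z, lin z, hHz, dotProduct_comm z η'] at hv
  rw [hone, quad 1, lin 1]
  have l1 := lin' 1
  have l2 := lin' z
  rw [l1]
  linarith

/-- One dimensional density. -/
def auxpsi (ε : ℝ) (y : ℝ) : ENNReal :=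
  (Set.Ioc 0 ε).indicator
    (fun y => ENNReal.ofReal ((2 / Real.pi) ^ ((1 : ℝ) / 2) / Real.sqrt y)) y

lemma aux_dens (W : Matrix (Unit ⊕ ι) (Unit ⊕ ι) ℝ) (hW : ∀ a b, W a b = W b a)
    (h0 : W (Sum.inl ()) (Sum.inl ()) = 0) (η β : Unit ⊕ ι → ℝ) (K : ℝ) (hK : 0 < K)
    (hPD : (Hmat W β).PosDef) (hG : K ≤ (Hmat W β)⁻¹ (Sum.inl ()) (Sum.inl ())) :
    nuDens W η β ≤ nuDens (W.submatrix Sum.inr Sum.inr) (fun j => η (Sum.inr j) + auxw W j)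
      (β ∘ Sum.inr) * auxpsi K⁻¹ (2 * β (Sum.inl ()) - auxc W (β ∘ Sum.inr)) := by
  have hPD' := aux_subPD W β hPD
  have h1 := aux_G W hW h0 β hPD
  have h2 := aux_det W hW h0 β hPD
  have h3 := aux_exponent W hW h0 η β hPD _ rfl _ rfl
  have hd := hPD'.det_pos
  set y := 2 * β (Sum.inl ()) - auxc W (β ∘ Sum.inr) with hy
  set g := (Hmat W β)⁻¹ (Sum.inl ()) (Sum.inl ()) with hg
  have hg0 : 0 < g := lt_of_lt_of_le hK hG
  have hy0 : 0 < y := by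
    by_contra h
    push Not at h
    nlinarith
  have hyK : y ≤ K⁻¹ := by
    have : y = g⁻¹ := eq_inv_of_mul_eq_one_left h1
    rw [this]; exact inv_anti₀ hK hG
  unfold nuDens auxpsi
  rw [Set.indicator_of_mem (by exact hPD), Set.indicator_of_mem (by exact hPD'),
    Set.indicator_of_mem (by exact ⟨hy0, hyK⟩), ← ENNReal.ofReal_mul (by positivity)]
  apply ENNReal.ofReal_le_ofReal
  rw [h2, Real.sqrt_mul hd.le]
  have hc : ((2:ℝ) / Real.pi) ^ ((Fintype.card (Unit ⊕ ι) : ℝ) / 2) =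
      (2 / Real.pi) ^ ((Fintype.card ι : ℝ) / 2) * (2 / Real.pi) ^ ((1 : ℝ) / 2) := by
    rw [← Real.rpow_add (by positivity)]
    congr 1
    simp [Fintype.card_sum]
    ring
  rw [hc]
  have he := Real.exp_le_exp.2 h3
  have hs1 : 0 < Real.sqrt (Hmat (W.submatrix Sum.inr Sum.inr) (β ∘ Sum.inr)).det := Real.sqrt_pos.2 hd
  have hs2 : 0 < Real.sqrt y := Real.sqrt_pos.2 hy0
  rw [div_mul_div_comm]
  refine div_le_div_of_nonneg_right ?_ (by positivity)
  rw [mul_right_comm]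
  gcongr

end block

lemma aux_measurable_entry {A : Type*} [Fintype A] [DecidableEq A] (W : Matrix A A ℝ) (i j : A) :
    Continuous fun β : A → ℝ => Hmat W β i j := by
  simp only [aux_Hmat_apply]
  split_ifs <;> fun_prop

lemma aux_cont_H {A : Type*} [Fintype A] [DecidableEq A] (W : Matrix A A ℝ) :
    Continuous fun β : A → ℝ => Hmat W β :=
  continuous_matrix fun i j => aux_measurable_entry W i j

lemma aux_meas_PD {A : Type*} [Fintype A] [DecidableEq A] (W : Matrix A A ℝ) :
    MeasurableSet {β : A → ℝ | (Hmat W β).PosDef} := by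
  have e : {β : A → ℝ | (Hmat W β).PosDef} =
      {β : A → ℝ | (Hmat W β).PosSemidef} ∩ {β : A → ℝ | (Hmat W β).det ≠ 0} := by
    ext β
    simp only [Set.mem_ofPred_eq, Set.mem_inter_iff]
    constructor
    · intro h; exact ⟨h.posSemidef, h.det_pos.ne'⟩
    · rintro ⟨h1, h2⟩; exact h1.posDef_iff_det_ne_zero.2 h2
  rw [e]
  have hc := aux_cont_H W
  refine MeasurableSet.inter ?_ ?_
  · have e2 : {β : A → ℝ | (Hmat W β).PosSemidef} =
        {β : A → ℝ | (Hmat W β)ᴴ = Hmat W β} ∩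
          ⋂ x : A → ℝ, {β : A → ℝ | 0 ≤ star x ⬝ᵥ (Hmat W β *ᵥ x)} := by
      ext β
      simp [posSemidef_iff_dotProduct_mulVec, IsHermitian]
    rw [e2]
    refine (IsClosed.inter ?_ (isClosed_iInter fun x => ?_)).measurableSet
    · exact isClosed_eq hc.matrix_conjTranspose hc
    · exact isClosed_le continuous_const (continuous_const.dotProduct (hc.matrix_mulVec continuous_const))
  · exact (isOpen_ne_fun hc.matrix_det continuous_const).measurableSet

lemma aux_meas_inv {A : Type*} [Fintype A] [DecidableEq A] (W : Matrix A A ℝ) (i j : A) :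
    Measurable fun β : A → ℝ => (Hmat W β)⁻¹ i j := by
  have hc := aux_cont_H W
  simp only [inv_def, Ring.inverse_eq_inv', Matrix.smul_apply, smul_eq_mul]
  exact hc.matrix_det.measurable.inv.mul (hc.matrix_adjugate.matrix_elem i j).measurable

lemma aux_reindex {A B : Type*} [Fintype A] [DecidableEq A] [Fintype B] [DecidableEq B]
    (e : B ≃ A) (W : Matrix A A ℝ) (β : A → ℝ) :
    Hmat (W.submatrix e e) (β ∘ e) = (Hmat W β).submatrix e e := by
  ext i j
  simp [aux_Hmat_apply]

lemma aux_nuDens_reindex {A B : Type*} [Fintype A] [DecidableEq A] [Fintype B] [DecidableEq B]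
    (e : B ≃ A) (W : Matrix A A ℝ) (η β : A → ℝ) :
    nuDens (W.submatrix e e) (η ∘ e) (β ∘ e) = nuDens W η β := by
  have hdot : ∀ x y : A → ℝ, (x ∘ e) ⬝ᵥ (y ∘ e) = x ⬝ᵥ y := fun x y =>
    Equiv.sum_comp e fun i => x i * y i
  have hmv : ∀ (M : Matrix A A ℝ) (x : A → ℝ), (M.submatrix e e) *ᵥ (x ∘ e) = (M *ᵥ x) ∘ e := by
    intro M x
    rw [submatrix_mulVec_equiv]
    congr 2
    ext i; simp
  have h1 : (1 : B → ℝ) = (1 : A → ℝ) ∘ e := rfl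
  unfold nuDens
  by_cases h : (Hmat W β).PosDef
  · have h' : (Hmat (W.submatrix e e) (β ∘ e)).PosDef := by
      rw [aux_reindex]; exact h.submatrix e.injective
    rw [Set.indicator_of_mem (by exact h'), Set.indicator_of_mem (by exact h)]
    rw [aux_reindex, inv_submatrix_equiv, h1, hmv, hmv, hdot, hdot, hdot, det_submatrix_equiv_self,
      Fintype.card_congr e]
  · have h' : ¬ (Hmat (W.submatrix e e) (β ∘ e)).PosDef := by
      intro hh
      apply h
      have := hh.submatrix e.symm.injective
      rw [aux_reindex] at this
      simpa using this
    rw [Set.indicator_of_notMem (by exact h'), Set.indicator_of_notMem (by exact h)]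

lemma aux_fubini {ι : Type*} [Fintype ι] (F : (Unit ⊕ ι → ℝ) → ENNReal) :
    ∫⁻ β, F β ≤ ∫⁻ β' : ι → ℝ, ∫⁻ b : ℝ, F (Sum.elim (fun _ => b) β') := by
  have h1 := volume_measurePreserving_sumPiEquivProdPi_symm (fun _ : Unit ⊕ ι => ℝ)
  rw [h1.lintegral_map_equiv F]
  rw [Measure.volume_eq_prod, ← lintegral_prod_swap]
  refine (lintegral_prod_le _).trans ?_
  refine lintegral_mono fun β' => ?_
  have h2 := (volume_preserving_funUnique Unit ℝ).symm
  rw [h2.lintegral_map_equiv]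
  refine le_of_eq (lintegral_congr fun b => ?_)
  congr 1

/-- The universal tail function. -/
def auxphi (ε : ℝ) : ENNReal := ∫⁻ b : ℝ, auxpsi ε (2 * b)

lemma aux_psi_meas (ε : ℝ) : Measurable (auxpsi ε) := by
  unfold auxpsi
  refine Measurable.indicator ?_ measurableSet_Ioc
  fun_prop

lemma aux_phi_one : auxphi 1 ≠ ⊤ := by
  unfold auxphi
  have e : ∀ b : ℝ, auxpsi 1 (2 * b) ≤ (Set.Ioc (0:ℝ) 1).indicator
      (fun b => ENNReal.ofReal ((2 / Real.pi) ^ ((1 : ℝ) / 2) * b ^ (-(1/2) : ℝ))) b := by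
    intro b
    unfold auxpsi
    by_cases hb : 2 * b ∈ Set.Ioc (0:ℝ) 1
    · have hb0 : 0 < b := by linarith [hb.1]
      rw [Set.indicator_of_mem hb, Set.indicator_of_mem (by constructor <;> linarith [hb.1, hb.2])]
      apply ENNReal.ofReal_le_ofReal
      rw [div_eq_mul_inv, Real.rpow_neg hb0.le, ← Real.sqrt_eq_rpow b]
      have := Real.sqrt_pos.2 hb0
      gcongr
      linarith
    · rw [Set.indicator_of_notMem hb]; simp
  refine ne_top_of_le_ne_top ?_ (lintegral_mono e)
  rw [lintegral_indicator measurableSet_Ioc]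
  have hi : IntegrableOn (fun b : ℝ => (2 / Real.pi) ^ ((1 : ℝ) / 2) * b ^ (-(1/2) : ℝ))
      (Set.Ioc 0 1) := by
    have := (intervalIntegral.intervalIntegrable_rpow' (a := 0) (b := 1) (r := -(1/2))
      (by norm_num)).const_mul ((2 / Real.pi) ^ ((1 : ℝ) / 2))
    rwa [intervalIntegrable_iff_integrableOn_Ioc_of_le zero_le_one] at this
  exact hi.lintegral_lt_top.ne

lemma aux_phi_ne_top (ε : ℝ) (hε : ε ≤ 1) : auxphi ε ≠ ⊤ := by
  refine ne_top_of_le_ne_top aux_phi_one (lintegral_mono fun b => ?_)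
  exact Set.indicator_le_indicator_of_subset (Set.Ioc_subset_Ioc_right hε) (fun _ => zero_le) _

lemma aux_phi_tendsto :
    Filter.Tendsto (fun n : ℕ => auxphi ((n : ℝ) + 1)⁻¹) Filter.atTop (nhds 0) := by
  have h0 : (0 : ENNReal) = ∫⁻ _ : ℝ, 0 := by simp
  rw [h0]
  refine tendsto_lintegral_of_dominated_convergence (fun b => auxpsi 1 (2 * b))
    (fun n => (aux_psi_meas _).comp (measurable_const_mul 2)) (fun n => ?_) aux_phi_one ?_
  · refine Filter.Eventually.of_forall fun b => ?_
    refine Set.indicator_le_indicator_of_subset (Set.Ioc_subset_Ioc_right ?_) (fun _ => zero_le) _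
    exact inv_le_one_of_one_le₀ (by linarith [Nat.cast_nonneg (α := ℝ) n])
  · refine Filter.Eventually.of_forall fun b => ?_
    refine tendsto_const_nhds.congr' ?_
    by_cases hb : 0 < 2 * b
    · have ht : Filter.Tendsto (fun n : ℕ => ((n : ℝ) + 1)⁻¹) Filter.atTop (nhds 0) := by
        simpa using tendsto_one_div_add_atTop_nhds_zero_nat (𝕜 := ℝ)
      filter_upwards [ht.eventually_lt_const hb] with n hn
      unfold auxpsi
      rw [Set.indicator_of_notMem]
      intro h; exact absurd h.2 (not_le.2 hn)
    · refine Filter.Eventually.of_forall fun n => ?_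
      simp only [auxpsi]
      rw [Set.indicator_of_notMem]
      intro h; exact hb h.1

lemma aux_tail {A ι : Type*} [Fintype A] [DecidableEq A] [Fintype ι] [DecidableEq ι]
    (e : Unit ⊕ ι ≃ A) (W : Matrix A A ℝ) (hW : ∀ a b, W a b = W b a)
    (h0 : ∀ a, W a a = 0) (η : A → ℝ) (K : ℝ) (hK : 1 ≤ K) :
    nuMeas W η {β | (Hmat W β).PosDef ∧ K ≤ (Hmat W β)⁻¹ (e (Sum.inl ())) (e (Sum.inl ()))} ≤
      nuMeas (W.submatrix (fun j => e (Sum.inr j)) (fun j => e (Sum.inr j)))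
        (fun j => η (e (Sum.inr j)) + W (e (Sum.inl ())) (e (Sum.inr j))) Set.univ
        * auxphi K⁻¹ := by
  have hK0 : 0 < K := by linarith
  set S := {β | (Hmat W β).PosDef ∧ K ≤ (Hmat W β)⁻¹ (e (Sum.inl ())) (e (Sum.inl ()))} with hS
  have hSm : MeasurableSet S :=
    (aux_meas_PD W).inter (measurableSet_le measurable_const (aux_meas_inv W _ _))
  set We := W.submatrix e e with hWe
  set D : (ι → ℝ) → ENNReal := nuDens (We.submatrix Sum.inr Sum.inr)
    (fun j => (η ∘ e) (Sum.inr j) + auxw We j) with hD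
  have hphi : auxphi K⁻¹ ≠ ⊤ := aux_phi_ne_top _ (inv_le_one_of_one_le₀ hK)
  have hRHS : nuMeas (W.submatrix (fun j => e (Sum.inr j)) (fun j => e (Sum.inr j)))
        (fun j => η (e (Sum.inr j)) + W (e (Sum.inl ())) (e (Sum.inr j))) Set.univ
      = ∫⁻ β', D β' := by
    rw [nuMeas, withDensity_apply _ MeasurableSet.univ, Measure.restrict_univ]
    rfl
  rw [hRHS, nuMeas, withDensity_apply _ hSm, ← lintegral_indicator hSm]
  have hp := volume_preserving_arrowCongr' e (MeasurableEquiv.refl ℝ) (MeasurePreserving.id volume)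
  rw [hp.lintegral_map_equiv]
  have hle : ∀ γ : Unit ⊕ ι → ℝ, S.indicator (nuDens W η)
      (MeasurableEquiv.arrowCongr' e (MeasurableEquiv.refl ℝ) γ) ≤
      D (γ ∘ Sum.inr) * auxpsi K⁻¹ (2 * γ (Sum.inl ()) - auxc We (γ ∘ Sum.inr)) := by
    intro γ
    set β := MeasurableEquiv.arrowCongr' e (MeasurableEquiv.refl ℝ) γ with hβ
    have hγ : γ = β ∘ e := by
      ext a
      have : β (e a) = γ (e.symm (e a)) := rfl
      simp [this]
    by_cases hb : β ∈ S
    · rw [Set.indicator_of_mem hb, ← aux_nuDens_reindex e, ← hγ]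
      refine aux_dens We (fun a b => hW _ _) (h0 _) (η ∘ e) γ K hK0 ?_ ?_
      · rw [hγ, aux_reindex]; exact hb.1.submatrix e.injective
      · rw [hγ, aux_reindex, inv_submatrix_equiv]; exact hb.2
    · rw [Set.indicator_of_notMem hb]; exact zero_le
  refine (lintegral_mono hle).trans ((aux_fubini _).trans ?_)
  rw [← lintegral_mul_const' _ _ hphi]
  refine lintegral_mono fun β' => ?_
  have hc : ∀ b : ℝ, (Sum.elim (fun _ : Unit => b) β') ∘ Sum.inr = β' := fun b => rfl
  simp only [hc, Sum.elim_inl]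
  rw [lintegral_const_mul _ (by
    exact (aux_psi_meas _).comp ((measurable_const_mul 2).sub_const _))]
  gcongr
  have := lintegral_sub_right_eq_self (μ := (volume : Measure ℝ)) (fun b => auxpsi K⁻¹ (2 * b)) (auxc We β' / 2)
  rw [auxphi, ← this]
  refine lintegral_mono fun b => le_of_eq ?_
  congr 1
  ring

lemma aux_tail_nu {V : Type*} [DecidableEq V]
    (W : V → V → ℝ) (hsymm : ∀ i j, W i j = W j i) (hnn : ∀ i j, 0 ≤ W i j)
    (hdiag : ∀ i, W i i = 0) (hloc : ∀ i, {j | 0 < W i j}.Finite)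
    (ν : Measure (V → ℝ)) (hprob : IsProbabilityMeasure ν) (hν : RestrictionProp W ν)
    (U : Finset V) (i : V) (hi : i ∈ U) (ht : (U.erase i).Nonempty) (K : ℝ) (hK : 1 ≤ K) :
    ν {β | (HmatRestr W β U).PosDef ∧ K ≤ (HmatRestr W β U)⁻¹ ⟨i, hi⟩ ⟨i, hi⟩} ≤
      auxphi K⁻¹ := by
  have hm : ∀ U : Finset V, Measurable (fun (β : V → ℝ) (i : ↥U) => β i.1) := fun U => by fun_prop
  let f : Unit ⊕ ↥(U.erase i) → ↥U :=
    Sum.elim (fun _ => ⟨i, hi⟩) (fun j => ⟨j.1, Finset.mem_of_mem_erase j.2⟩)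
  have hf : Function.Bijective f := by
    constructor
    · rintro (⟨⟩ | ⟨a, ha⟩) (⟨⟩ | ⟨b, hb⟩) h
      · rfl
      · simp [f] at h; subst h; simp at hb
      · simp [f] at h; subst h; simp at ha
      · simp [f] at h; subst h; rfl
    · rintro ⟨a, ha⟩
      by_cases h : a = i
      · subst h; exact ⟨Sum.inl (), rfl⟩
      · exact ⟨Sum.inr ⟨a, Finset.mem_erase.2 ⟨h, ha⟩⟩, rfl⟩
  let e : Unit ⊕ ↥(U.erase i) ≃ ↥U := Equiv.ofBijective f hf
  have h1 := Measure.le_map_apply (μ := ν) (hm U).aemeasurable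
    {β : U → ℝ | (Hmat (Matrix.of fun i j : ↥U => W i.1 j.1) β).PosDef ∧
      K ≤ (Hmat (Matrix.of fun i j : ↥U => W i.1 j.1) β)⁻¹ ⟨i, hi⟩ ⟨i, hi⟩}
  rw [hν U ⟨i, hi⟩] at h1
  have h2 := aux_tail e (Matrix.of fun i j : ↥U => W i.1 j.1) (fun a b => hsymm _ _)
    (fun a => hdiag _) (fun i : ↥U => ∑' j : V, if j ∈ U then 0 else W i.1 j) K hK
  have h3 : nuMeas ((Matrix.of fun i j : ↥U => W i.1 j.1).submatrix
        (fun j => e (Sum.inr j)) (fun j => e (Sum.inr j)))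
        (fun j => (fun i : ↥U => ∑' j : V, if j ∈ U then 0 else W i.1 j) (e (Sum.inr j)) +
          (Matrix.of fun i j : ↥U => W i.1 j.1) (e (Sum.inl ())) (e (Sum.inr j))) Set.univ = 1 := by
    have h4 := hν (U.erase i) ht
    have hη : (fun j : ↥(U.erase i) =>
        (fun i : ↥U => ∑' j : V, if j ∈ U then 0 else W i.1 j) (e (Sum.inr j)) +
          (Matrix.of fun i j : ↥U => W i.1 j.1) (e (Sum.inl ())) (e (Sum.inr j))) =
        (fun k : ↥(U.erase i) => ∑' j : V, if j ∈ U.erase i then 0 else W k.1 j) := by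
      ext k
      have hk : (e (Sum.inr k)).1 = k.1 := rfl
      have hi' : (e (Sum.inl ())).1 = i := rfl
      simp only [of_apply, hk, hi']
      have hfin : (Function.support fun j => if j ∈ U then 0 else W k.1 j).Finite := by
        refine (hloc k.1).subset fun j hj => ?_
        simp only [Function.mem_support] at hj
        have : W k.1 j ≠ 0 := by
          intro h; apply hj; simp [h]
        exact lt_of_le_of_ne (hnn _ _) this.symm
      have hs1 : Summable fun j => if j ∈ U then 0 else W k.1 j :=
        summable_of_hasFiniteSupport hfin
      have hs2 : Summable fun j => if j = i then W k.1 j else 0 :=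
        summable_of_hasFiniteSupport ((Set.finite_singleton i).subset fun j hj => by
          simp only [Function.mem_support] at hj
          by_contra h
          apply hj
          simp at h
          simp [h])
      rw [hsymm i k.1]
      rw [← tsum_ite_eq i (fun j => W k.1 j), ← hs1.tsum_add hs2]
      refine tsum_congr fun j => ?_
      by_cases hj : j = i
      · subst hj; simp [hi]
      · simp [hj]
    rw [hη]
    have h5 : nuMeas (Matrix.of fun i_1 j : ↥(U.erase i) => W i_1.1 j.1)
        (fun k : ↥(U.erase i) => ∑' j : V, if j ∈ U.erase i then 0 else W k.1 j) Set.univ = 1 := by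
      rw [← h4, Measure.map_apply (hm _) MeasurableSet.univ]
      simp
    exact h5
  rw [h3, one_mul] at h2
  exact h1.trans h2

lemma aux_PD_ae {V : Type*} [DecidableEq V]
    (W : V → V → ℝ) (ν : Measure (V → ℝ)) (hν : RestrictionProp W ν)
    (U : Finset V) (hU : U.Nonempty) : ∀ᵐ β ∂ν, (HmatRestr W β U).PosDef := by
  have hm : Measurable (fun (β : V → ℝ) (i : ↥U) => β i.1) := by fun_prop
  refine ae_of_ae_map (f := fun (β : V → ℝ) (i : ↥U) => β i.1) (p := fun β : U → ℝ =>
    (Hmat (Matrix.of fun i j : ↥U => W i.1 j.1) β).PosDef) hm.aemeasurable ?_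
  rw [hν U hU, ae_iff, nuMeas]
  have hs : MeasurableSet {β : U → ℝ | ¬ (Hmat (Matrix.of fun i j : ↥U => W i.1 j.1) β).PosDef} :=
    (aux_meas_PD _).compl
  rw [withDensity_apply _ hs, setLIntegral_congr_fun (g := fun _ => 0) hs]
  · simp
  · intro β hβ
    exact Set.indicator_of_notMem (by exact hβ) _

theorem stmt12 {V : Type*} [Countable V] [Infinite V] [DecidableEq V]
    (W : V → V → ℝ) (hsymm : ∀ i j, W i j = W j i) (hnn : ∀ i j, 0 ≤ W i j)
    (hdiag : ∀ i, W i i = 0) (hloc : ∀ i, {j | 0 < W i j}.Finite)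
    (hconn : (SimpleGraph.fromRel fun i j => 0 < W i j).Connected)
    (ν : Measure (V → ℝ)) (hprob : IsProbabilityMeasure ν) (hν : RestrictionProp W ν)
    (Vseq : ℕ → Finset V) (hmono : Monotone Vseq) (hne : ∀ n, (Vseq n).Nonempty)
    (hconn' : ∀ n, ((SimpleGraph.fromRel fun i j => 0 < W i j).induce
        (↑(Vseq n) : Set V)).Connected)
    (hexh : ∀ i : V, ∃ n, i ∈ Vseq n) :
    ∀ᵐ β ∂ν,
      (∀ U : Finset V, U.Nonempty → (HmatRestr W β U).PosDef) ∧
      ∀ i j : V, ∃ N : ℕ, i ∈ Vseq N ∧ j ∈ Vseq N ∧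
        (∀ m n : ℕ, N ≤ m → m ≤ n → GhatSeq W Vseq β i j m ≤ GhatSeq W Vseq β i j n) ∧
        ∃ L : ℝ, Filter.Tendsto (GhatSeq W Vseq β i j) Filter.atTop (nhds L) := by
  have hgood : ∀ᵐ β ∂ν, ∀ U : Finset V, U.Nonempty → (HmatRestr W β U).PosDef := by
    rw [ae_all_iff]
    intro U
    by_cases hU : U.Nonempty
    · filter_upwards [aux_PD_ae W ν hν U hU] with β hβ _ using hβ
    · exact Filter.Eventually.of_forall fun β h => absurd h hU
  -- monotonicity on good configurations
  have hmonoG : ∀ β : V → ℝ, (∀ U : Finset V, U.Nonempty → (HmatRestr W β U).PosDef) →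
      ∀ i j N, i ∈ Vseq N → j ∈ Vseq N → ∀ m n : ℕ, N ≤ m → m ≤ n →
        GhatSeq W Vseq β i j m ≤ GhatSeq W Vseq β i j n := by
    intro β hβ i j N hi hj m n hm hn
    have him := hmono hm hi
    have hjm := hmono hm hj
    unfold GhatSeq
    rw [dif_pos ⟨him, hjm⟩, dif_pos ⟨hmono hn him, hmono hn hjm⟩]
    exact aux_mono W hnn β _ _ (hmono hn) (hβ _ (hne m)) (hβ _ (hne n)) i j him hjm
  have hbdd : ∀ i : V, ∀ᵐ β ∂ν, ∃ K : ℝ, ∀ n, GhatSeq W Vseq β i i n ≤ K := by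
    intro i
    obtain ⟨N1, hN1⟩ := hexh i
    obtain ⟨k, hk⟩ := exists_ne i
    obtain ⟨N2, hN2⟩ := hexh k
    set N := max N1 N2 with hN
    have hiN : i ∈ Vseq N := hmono (le_max_left _ _) hN1
    have hkN : k ∈ Vseq N := hmono (le_max_right _ _) hN2
    let Good : Set (V → ℝ) := {β | ∀ U : Finset V, U.Nonempty → (HmatRestr W β U).PosDef}
    let S : ℕ → ℕ → Set (V → ℝ) := fun K n =>
      {β | β ∈ Good ∧ (K : ℝ) + 1 ≤ GhatSeq W Vseq β i i (N + n)}
    have hS : ∀ K n, ν (S K n) ≤ auxphi ((K : ℝ) + 1)⁻¹ := by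
      intro K n
      have hin : i ∈ Vseq (N + n) := hmono (Nat.le_add_right _ _) hiN
      have hkn : k ∈ Vseq (N + n) := hmono (Nat.le_add_right _ _) hkN
      refine le_trans (measure_mono ?_) (aux_tail_nu W hsymm hnn hdiag hloc ν hprob hν
        (Vseq (N + n)) i hin ⟨k, Finset.mem_erase.2 ⟨hk, hkn⟩⟩ ((K : ℝ) + 1)
        (by linarith [Nat.cast_nonneg (α := ℝ) K]))
      rintro β ⟨hβ, hK⟩
      refine ⟨hβ _ (hne _), ?_⟩
      unfold GhatSeq at hK
      rwa [dif_pos ⟨hin, hin⟩] at hK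
    have hU : ∀ K, ν (⋃ n, S K n) ≤ auxphi ((K : ℝ) + 1)⁻¹ := by
      intro K
      have hmS : Monotone (S K) := by
        rintro m n hmn β ⟨hβ, hK⟩
        exact ⟨hβ, hK.trans (hmonoG β hβ i i N hiN hiN _ _ (Nat.le_add_right _ _) (by omega))⟩
      rw [hmS.measure_iUnion]
      exact iSup_le (hS K)
    have hI : ν (⋂ K, ⋃ n, S K n) = 0 := by
      refine le_antisymm ?_ zero_le
      exact ge_of_tendsto' aux_phi_tendsto fun K =>
        (measure_mono (Set.iInter_subset _ K)).trans (hU K)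
    have hI' : ∀ᵐ β ∂ν, β ∉ ⋂ K, ⋃ n, S K n := measure_eq_zero_iff_ae_notMem.1 hI
    filter_upwards [hgood, hI'] with β hβ hnot
    simp only [Set.mem_iInter, Set.mem_iUnion, not_forall, not_exists] at hnot
    obtain ⟨K, hK⟩ := hnot
    have hlt : ∀ n, GhatSeq W Vseq β i i (N + n) < (K : ℝ) + 1 := by
      intro n
      by_contra h
      exact hK n ⟨hβ, not_lt.1 h⟩
    refine ⟨(K : ℝ) + 1, fun n => ?_⟩
    by_cases hin : i ∈ Vseq n
    · refine (hmonoG β hβ i i n hin hin n (N + n) le_rfl (by omega)).trans (hlt n).le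
    · unfold GhatSeq
      rw [dif_neg (fun h => hin h.1)]
      positivity
  have hbdd' := ae_all_iff.2 hbdd
  filter_upwards [hgood, hbdd'] with β hβ hb
  refine ⟨hβ, fun i j => ?_⟩
  obtain ⟨N1, hN1⟩ := hexh i
  obtain ⟨N2, hN2⟩ := hexh j
  set N := max N1 N2 with hN
  have hiN : i ∈ Vseq N := hmono (le_max_left _ _) hN1
  have hjN : j ∈ Vseq N := hmono (le_max_right _ _) hN2
  refine ⟨N, hiN, hjN, hmonoG β hβ i j N hiN hjN, ?_⟩
  obtain ⟨K1, hK1⟩ := hb i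
  obtain ⟨K2, hK2⟩ := hb j
  have hm' : Monotone fun n => GhatSeq W Vseq β i j (n + N) := fun m n hmn =>
    hmonoG β hβ i j N hiN hjN _ _ (Nat.le_add_left _ _) (by omega)
  have hbd : BddAbove (Set.range fun n => GhatSeq W Vseq β i j (n + N)) := by
    refine ⟨K1 + K2, ?_⟩
    rintro _ ⟨n, rfl⟩
    have hin : i ∈ Vseq (n + N) := hmono (Nat.le_add_left _ _) hiN
    have hjn : j ∈ Vseq (n + N) := hmono (Nat.le_add_left _ _) hjN
    have a1 := hK1 (n + N)
    have a2 := hK2 (n + N)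
    unfold GhatSeq at a1 a2
    simp only [GhatSeq]
    rw [dif_pos ⟨hin, hin⟩] at a1
    rw [dif_pos ⟨hjn, hjn⟩] at a2
    rw [dif_pos ⟨hin, hjn⟩]
    have := aux_offdiag _ (hβ _ (hne (n + N))).posSemidef.inv ⟨i, hin⟩ ⟨j, hjn⟩
    linarith
  exact ⟨_, (Filter.tendsto_add_atTop_iff_nat N).1 (tendsto_atTop_ciSup hm' hbd)⟩

end
end

section
/- For n ∈ ℕ set η^{(n)}_j = Σ_{k∉V_n} W_{jk} for j ∈ V_n, and for β such that (H_β)_{V_n,V_n} is positive definite set ψ^{(n)}(i) = Σ_{j∈V_n} ((H_β)_{V_n,V_n})^{-1}(i,j)·η^{(n)}_j for i ∈ V_n. Then, on the probability space (ℝ^V, ν) with the filtration F_n = σ(β_j : j ∈ V_n): for each i ∈ V, the process (ψ^{(n)}(i))_{n : i∈V_n} is a nonnegative martingale; it converges ν-almost surely to an integrable random variable ψ(i); and ν-almost surely, for every i ∈ V, 2β_i ψ(i) = Σ_{j∈V} W_{ij} ψ(j) (a finite sum). -/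
open MeasureTheory Matrix

noncomputable section

/-- `ψ^{(n)}(i) = Σ_{j∈V_n} ((H_β)_{V_n,V_n})^{-1}(i,j)·η^{(n)}_j`, with
`η^{(n)}_j = Σ_{k∉V_n} W j k`, and junk value `0` when `i ∉ V_n`. -/
def psiSeq {V : Type*} [DecidableEq V] (W : V → V → ℝ) (Vseq : ℕ → Finset V)
    (n : ℕ) (i : V) (β : V → ℝ) : ℝ :=
  if h : i ∈ Vseq n then
    ∑ j : ↥(Vseq n), (HmatRestr W β (Vseq n))⁻¹ ⟨i, h⟩ j
      * ∑' k : V, if k ∈ Vseq n then 0 else W j.1 k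
  else 0

/-- The σ-algebra `F_n = σ(β_j : j ∈ V_n)` on `ℝ^V`. -/
def filtr {V : Type*} (Vseq : ℕ → Finset V) (n : ℕ) : MeasurableSpace (V → ℝ) :=
  MeasurableSpace.comap (fun (β : V → ℝ) (j : ↥(Vseq n)) => β j.1) inferInstance


/-! ### Linear algebra -/

lemma aux_pd_quad {ι : Type*} [Fintype ι] {H : Matrix ι ι ℝ} (hH : H.PosDef) {x : ι → ℝ}
    (hx : x ≠ 0) : 0 < x ⬝ᵥ H *ᵥ x := by
  simpa using hH.dotProduct_mulVec_pos hx

lemma aux_pd_quad_nonneg {ι : Type*} [Fintype ι] {H : Matrix ι ι ℝ} (hH : H.PosDef) (x : ι → ℝ) :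
    0 ≤ x ⬝ᵥ H *ᵥ x := by
  by_cases hx : x = 0
  · simp [hx]
  · exact (aux_pd_quad hH hx).le

lemma aux_inv_mulVec {ι : Type*} [Fintype ι] [DecidableEq ι] {H : Matrix ι ι ℝ} (hH : H.PosDef)
    (x : ι → ℝ) : H *ᵥ (H⁻¹ *ᵥ x) = x := by
  rw [Matrix.mulVec_mulVec, Matrix.mul_nonsing_inv _ ((Matrix.isUnit_iff_isUnit_det _).1 hH.isUnit),
    Matrix.one_mulVec]

lemma aux_inv_eq {ι : Type*} [Fintype ι] [DecidableEq ι] {H : Matrix ι ι ℝ} (hH : H.PosDef)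
    {x y : ι → ℝ} (h : H *ᵥ x = y) : H⁻¹ *ᵥ y = x := by
  rw [← h, Matrix.mulVec_mulVec, Matrix.nonsing_inv_mul _ ((Matrix.isUnit_iff_isUnit_det _).1 hH.isUnit),
    Matrix.one_mulVec]

lemma aux_nonneg {ι : Type*} [Fintype ι] [DecidableEq ι] {H : Matrix ι ι ℝ} (hH : H.PosDef)
    (hoff : ∀ i j, i ≠ j → H i j ≤ 0) {x : ι → ℝ} (hx : ∀ i, 0 ≤ (H *ᵥ x) i) (i : ι) : 0 ≤ x i := by
  by_contra hi
  push Not at hi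
  set y : ι → ℝ := fun i => max (-x i) 0 with hy
  have hy0 : y ≠ 0 := by
    intro h
    have := congrFun h i
    simp only [hy, Pi.zero_apply] at this
    have h2 := le_max_left (-x i) 0
    linarith
  have h1 := aux_pd_quad hH hy0
  have h2 : 0 ≤ y ⬝ᵥ H *ᵥ x := by
    apply Finset.sum_nonneg
    intro j _
    exact mul_nonneg (le_max_right _ _) (hx j)
  have h3 : y ⬝ᵥ H *ᵥ (x + y) ≤ 0 := by
    simp only [dotProduct, Matrix.mulVec, Finset.mul_sum]
    apply Finset.sum_nonpos
    intro j _
    apply Finset.sum_nonpos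
    intro k _
    have hyj : 0 ≤ y j := le_max_right _ _
    have hxk : 0 ≤ (x + y) k := by
      have := le_max_left (-x k) 0
      simp only [Pi.add_apply, hy]; linarith
    by_cases hjk : j = k
    · subst hjk
      have : y j * (x + y) j = 0 := by
        simp only [Pi.add_apply, hy]
        rcases le_total (-x j) 0 with h | h
        · rw [max_eq_right h]; simp
        · rw [max_eq_left h]; simp
      have : y j * (H j j * (x + y) j) = 0 := by
        linear_combination H j j * this
      exact this.le
    · have := mul_nonpos_of_nonpos_of_nonneg (hoff j k hjk) hxk
      exact mul_nonpos_of_nonneg_of_nonpos hyj this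
  rw [Matrix.mulVec_add, dotProduct_add] at h3
  linarith

lemma aux_single_mulVec {ι : Type*} [Fintype ι] [DecidableEq ι] (H : Matrix ι ι ℝ) (v : ι) (r : ℝ)
    (x : ι → ℝ) : (H + Matrix.single v v r) *ᵥ x = H *ᵥ x + Pi.single v (r * x v) := by
  rw [Matrix.add_mulVec]
  congr 1
  ext i
  rw [Matrix.single_mulVec]
  simp [Function.update_apply, Pi.single_apply]

lemma aux_col {ι : Type*} [Fintype ι] [DecidableEq ι] (G : Matrix ι ι ℝ) (v i : ι) :
    (G *ᵥ Pi.single v 1) i = G i v := by simp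

lemma aux_inv_symm {ι : Type*} [Fintype ι] [DecidableEq ι] {H : Matrix ι ι ℝ} (hH : H.PosDef)
    (x y : ι → ℝ) : x ⬝ᵥ H *ᵥ y = y ⬝ᵥ H *ᵥ x := by
  have : Hᵀ = H := by simpa [Matrix.IsHermitian] using hH.isHermitian
  rw [Matrix.dotProduct_mulVec, ← Matrix.mulVec_transpose, this, dotProduct_comm]

lemma aux_det_s13 {ι : Type*} [Fintype ι] [DecidableEq ι] {H : Matrix ι ι ℝ} (hH : H.PosDef)
    (v : ι) (r : ℝ) : (H + Matrix.single v v r).det = H.det * (1 + r * H⁻¹ v v) := by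
  have := Matrix.det_add_replicateCol_mul_replicateRow (ι := Unit)
    ((Matrix.isUnit_iff_isUnit_det _).1 hH.isUnit) (Pi.single v r) (Pi.single v 1)
  have e : (Matrix.single v v r : Matrix ι ι ℝ) =
      replicateCol Unit (Pi.single v r) * replicateRow Unit (Pi.single v (1:ℝ)) := by
    ext i j
    simp only [Matrix.single_apply, Matrix.mul_apply, replicateCol_apply, replicateRow_apply,
      Pi.single_apply]
    by_cases h1 : i = v <;> by_cases h2 : j = v <;>
      simp [h1, h2, eq_comm (a := v)]
  rw [e, this]
  congr 1
  rw [Matrix.det_unique]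
  simp [Matrix.mul_apply, Pi.single_apply, mul_comm]

lemma aux_pd_iff {ι : Type*} [Fintype ι] [DecidableEq ι] {H : Matrix ι ι ℝ} (hH : H.PosDef)
    (v : ι) (r : ℝ) : (H + Matrix.single v v r).PosDef ↔ 0 < 1 + r * H⁻¹ v v := by
  constructor
  · intro h
    have := h.det_pos
    rw [aux_det_s13 hH] at this
    exact (mul_pos_iff_of_pos_left hH.det_pos).1 this
  · intro h
    have hg : 0 < H⁻¹ v v := hH.inv.diag_pos
    apply Matrix.PosDef.of_dotProduct_mulVec_pos
    · apply hH.isHermitian.add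
      ext i j
      simp only [Matrix.conjTranspose_apply, Matrix.single_apply, star_trivial]
      by_cases h1 : v = i <;> by_cases h2 : v = j <;> simp [h1, h2]
    · intro x hx
      rw [star_trivial, aux_single_mulVec, dotProduct_add]
      simp only [dotProduct_single]
      by_cases hxv : x v = 0
      · simpa [hxv] using aux_pd_quad hH hx
      · set u : ι → ℝ := H⁻¹ *ᵥ Pi.single v 1 with hu
        have hHu : H *ᵥ u = Pi.single v 1 := aux_inv_mulVec hH _
        have huv : u v = H⁻¹ v v := aux_col _ _ _
        set c := x v / H⁻¹ v v with hc
        have h1 := aux_pd_quad_nonneg hH (x - c • u)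
        have h2 : (x - c • u) ⬝ᵥ H *ᵥ (x - c • u) = x ⬝ᵥ H *ᵥ x - x v * c := by
          have e1 : u ⬝ᵥ H *ᵥ x = x v := by
            rw [aux_inv_symm hH, hHu]; simp
          rw [Matrix.mulVec_sub, Matrix.mulVec_smul, sub_dotProduct, dotProduct_sub,
            dotProduct_sub, smul_dotProduct, smul_dotProduct, dotProduct_smul, dotProduct_smul, hHu, e1]
          simp only [dotProduct_single, huv, smul_eq_mul, hc]
          field_simp
          ring
        have h3 : 0 < x v * c + x v * (r * x v) := by
          have : x v * c + x v * (r * x v) = (x v) ^ 2 * ((1 + r * H⁻¹ v v) / H⁻¹ v v) := by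
            rw [hc]; field_simp
          rw [this]
          positivity
        linarith

lemma aux_inv_upd {ι : Type*} [Fintype ι] [DecidableEq ι] {H : Matrix ι ι ℝ} (hH : H.PosDef)
    (v : ι) (r : ℝ) (h : 0 < 1 + r * H⁻¹ v v) (η : ι → ℝ) :
    (H + Matrix.single v v r)⁻¹ *ᵥ η = H⁻¹ *ᵥ η
      - (r * (H⁻¹ *ᵥ η) v / (1 + r * H⁻¹ v v)) • (H⁻¹ *ᵥ Pi.single v 1) := by
  apply aux_inv_eq ((aux_pd_iff hH v r).2 h)
  rw [aux_single_mulVec, Matrix.mulVec_sub, Matrix.mulVec_smul, aux_inv_mulVec hH, aux_inv_mulVec hH]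
  ext i
  simp only [Pi.add_apply, Pi.sub_apply, Pi.smul_apply, smul_eq_mul, aux_col, Pi.single_apply]
  split_ifs
  · field_simp
    ring
  · simp

/-! ### The one dimensional integral -/

lemma aux_int (b c K : ℝ) (hb : 0 < b) :
    ∫⁻ t in {t : ℝ | 0 < 2 * t + c}, ENNReal.ofReal (b / (2 * t + c)) *
        ENNReal.ofReal (K * Real.exp (-(1/2) * ((2*t+c) + b^2 / (2*t+c))) / Real.sqrt (2*t+c))
    = ∫⁻ t in {t : ℝ | 0 < 2 * t + c},
        ENNReal.ofReal (K * Real.exp (-(1/2) * ((2*t+c) + b^2 / (2*t+c))) / Real.sqrt (2*t+c)) := by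
  set S := {t : ℝ | 0 < 2 * t + c} with hS
  have hSm : MeasurableSet S := measurableSet_lt (by fun_prop) (by fun_prop)
  set φ : ℝ → ℝ := fun t => (b^2 / (2*t+c) - c) / 2 with hφ
  have hφs : ∀ t, 2 * φ t + c = b^2 / (2*t+c) := by intro t; simp only [hφ]; ring
  have himg : φ '' S = S := by
    ext t
    constructor
    · rintro ⟨s, hs, rfl⟩
      simp only [hS, Set.mem_ofPred_eq] at hs ⊢
      rw [hφs]; positivity
    · intro ht
      simp only [hS, Set.mem_ofPred_eq] at ht
      refine ⟨φ t, ?_, ?_⟩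
      · simp only [hS, Set.mem_ofPred_eq]; rw [hφs]; positivity
      · have := hφs (φ t)
        rw [hφs t] at this
        have h2 : b^2 / (b^2 / (2*t+c)) = 2*t+c := by field_simp
        linarith
  have hinj : Set.InjOn φ S := by
    intro s hs t ht hst
    simp only [hS, Set.mem_ofPred_eq] at hs ht
    have : b^2 / (2*s+c) = b^2 / (2*t+c) := by rw [← hφs, ← hφs, hst]
    field_simp at this
    linarith
  have hder : ∀ t ∈ S, HasDerivWithinAt φ (-(b^2) / (2*t+c)^2) S t := by
    intro t ht
    simp only [hS, Set.mem_ofPred_eq] at ht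
    apply HasDerivAt.hasDerivWithinAt
    have h1 : HasDerivAt (fun t : ℝ => 2*t+c) 2 t := by
      simpa using ((hasDerivAt_id t).const_mul 2).add_const c
    have h2 := (((hasDerivAt_const t (b^2)).div h1 ht.ne').sub_const c).div_const 2
    exact h2.congr_deriv (by ring)
  conv_rhs => rw [← himg, lintegral_image_eq_lintegral_abs_deriv_mul hSm hder hinj]
  apply setLIntegral_congr_fun hSm
  intro t ht
  simp only [hS, Set.mem_ofPred_eq] at ht
  simp only [hφs]
  rw [← ENNReal.ofReal_mul (by positivity), ← ENNReal.ofReal_mul (by positivity)]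
  congr 1
  set s := 2*t+c with hs
  have e1 : |-(b^2)/s^2| = b^2/s^2 := by rw [neg_div, abs_neg, abs_of_nonneg (by positivity)]
  have e2 : b^2 / s + b^2/(b^2/s) = s + b^2/s := by
    have : b^2/(b^2/s) = s := by field_simp
    rw [this, add_comm]
  have e3 : Real.sqrt (b^2/s) = b / Real.sqrt s := by
    rw [Real.sqrt_div (by positivity), Real.sqrt_sq hb.le]
  rw [e1, e2, e3]
  have h4 : Real.sqrt s ^ 2 = s := Real.sq_sqrt ht.le
  have h5 : 0 < Real.sqrt s := Real.sqrt_pos.2 ht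
  set q := Real.sqrt s
  generalize Real.exp (-(1/2) * (s + b^2/s)) = E
  rw [← h4]
  field_simp

/-! ### The finite dimensional identity -/

lemma aux_Hmat_update {ι : Type*} [Fintype ι] [DecidableEq ι] (W : Matrix ι ι ℝ) (x : ι → ℝ) (v : ι)
    (t t0 : ℝ) : Hmat W (Function.update x v t) =
      Hmat W (Function.update x v t0) + Matrix.single v v (2 * (t - t0)) := by
  ext i j
  simp only [Hmat, Matrix.sub_apply, Matrix.smul_apply, Matrix.add_apply, Matrix.single_apply,
    Matrix.diagonal_apply, Function.update_apply]
  by_cases h1 : i = j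
  · subst h1
    by_cases h2 : i = v
    · subst h2; simp; ring
    · simp [h2, Ne.symm h2]
  · have : ¬ (v = i ∧ v = j) := by rintro ⟨rfl, rfl⟩; exact h1 rfl
    simp [h1, this]

lemma aux_Hmat_meas {ι : Type*} [Fintype ι] [DecidableEq ι] (W : Matrix ι ι ℝ) (i j : ι) :
    Continuous (fun β : ι → ℝ => Hmat W β i j) := by
  simp only [Hmat, Matrix.sub_apply, Matrix.smul_apply, Matrix.diagonal_apply]
  by_cases h : i = j
  · simp only [h, if_true]; fun_prop
  · simp only [h, if_false]; fun_prop

lemma aux_Hmat_cont {ι : Type*} [Fintype ι] [DecidableEq ι] (W : Matrix ι ι ℝ) :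
    Continuous (fun β : ι → ℝ => Hmat W β) :=
  continuous_matrix (aux_Hmat_meas W)

lemma aux_inv_meas {ι : Type*} [Fintype ι] [DecidableEq ι] (W : Matrix ι ι ℝ) (i j : ι) :
    Measurable (fun β : ι → ℝ => (Hmat W β)⁻¹ i j) := by
  simp only [Matrix.inv_def, Matrix.smul_apply, smul_eq_mul, Ring.inverse_eq_inv']
  apply Measurable.mul
  · exact ((aux_Hmat_cont W).matrix_det).measurable.inv
  · exact ((aux_Hmat_cont W).matrix_adjugate.matrix_elem i j).measurable

lemma aux_inv_mulVec_meas {ι : Type*} [Fintype ι] [DecidableEq ι] (W : Matrix ι ι ℝ) (η : ι → ℝ)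
    (i : ι) : Measurable (fun β : ι → ℝ => ((Hmat W β)⁻¹ *ᵥ η) i) := by
  simp only [Matrix.mulVec, dotProduct]
  exact Finset.measurable_sum _ fun j _ => (aux_inv_meas W i j).mul_const _

lemma aux_pd_meas {ι : Type*} [Fintype ι] [DecidableEq ι] (W : Matrix ι ι ℝ) :
    MeasurableSet {β : ι → ℝ | (Hmat W β).PosDef} := by
  by_cases hW : W.IsHermitian
  · have hH : ∀ β, (Hmat W β).IsHermitian := by
      intro β
      apply Matrix.IsHermitian.sub _ hW
      ext i j
      simp only [Matrix.conjTranspose_apply, Matrix.smul_apply, Matrix.diagonal_apply, star_trivial]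
      by_cases h : i = j
      · simp [h]
      · simp [h, Ne.symm h]
    have : {β : ι → ℝ | (Hmat W β).PosDef} =
        (⋂ x : ι → ℝ, {β | 0 ≤ x ⬝ᵥ Hmat W β *ᵥ x}) ∩ {β | (Hmat W β).det ≠ 0} := by
      ext β
      simp only [Set.mem_inter_iff, Set.mem_iInter, Set.mem_ofPred_eq]
      constructor
      · intro h
        exact ⟨fun x => aux_pd_quad_nonneg h x, h.det_pos.ne'⟩
      · rintro ⟨h1, h2⟩
        have : (Hmat W β).PosSemidef :=
          Matrix.PosSemidef.of_dotProduct_mulVec_nonneg (hH β) (by simpa using h1)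
        exact this.posDef_iff_det_ne_zero.2 h2
    rw [this]
    apply MeasurableSet.inter
    · apply IsClosed.measurableSet
      apply isClosed_iInter
      intro x
      apply isClosed_le continuous_const
      exact continuous_const.dotProduct ((aux_Hmat_cont W).matrix_mulVec continuous_const)
    · apply IsOpen.measurableSet
      exact isOpen_ne_fun (aux_Hmat_cont W).matrix_det continuous_const
  · have : {β : ι → ℝ | (Hmat W β).PosDef} = ∅ := by
      ext β
      simp only [Set.mem_ofPred_eq, Set.mem_empty_iff_false, iff_false]
      intro h
      apply hW
      have h1 := h.isHermitian
      have : W = 2 • Matrix.diagonal β - Hmat W β := by simp [Hmat]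
      rw [this]
      apply Matrix.IsHermitian.sub _ h1
      ext i j
      simp only [Matrix.conjTranspose_apply, Matrix.smul_apply, Matrix.diagonal_apply, star_trivial]
      by_cases h : i = j
      · simp [h]
      · simp [h, Ne.symm h]
    rw [this]; exact MeasurableSet.empty

lemma aux_dens_meas {ι : Type*} [Fintype ι] [DecidableEq ι] (W : Matrix ι ι ℝ) (η : ι → ℝ) :
    Measurable (nuDens W η) := by
  unfold nuDens
  apply Measurable.indicator _ (aux_pd_meas W)
  apply Measurable.ennreal_ofReal
  apply Measurable.div
  · apply Measurable.const_mul
    apply Real.measurable_exp.comp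
    apply Measurable.add_const
    apply Measurable.const_mul
    apply Measurable.add
    · exact (continuous_const.dotProduct
        ((aux_Hmat_cont W).matrix_mulVec continuous_const)).measurable
    · simp only [dotProduct]
      exact Finset.measurable_sum _ fun j _ => (aux_inv_mulVec_meas W η j).const_mul _
  · exact ((aux_Hmat_cont W).matrix_det).measurable.sqrt

lemma aux_one_dim {ι : Type*} [Fintype ι] [DecidableEq ι] (W : Matrix ι ι ℝ) (η : ι → ℝ) (v : ι)
    (hpos : ∀ β, (Hmat W β).PosDef → 0 < ((Hmat W β)⁻¹ *ᵥ η) v) (x : ι → ℝ) :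
    ∫⁻ t, ENNReal.ofReal (((Hmat W (Function.update x v t))⁻¹ *ᵥ η) v)
        * nuDens W η (Function.update x v t)
      = ∫⁻ t, nuDens W η (Function.update x v t) := by
  by_cases hex : ∃ t0, (Hmat W (Function.update x v t0)).PosDef
  swap
  · push Not at hex
    have : ∀ t, nuDens W η (Function.update x v t) = 0 := by
      intro t
      apply Set.indicator_of_notMem
      exact hex t
    simp [this]
  obtain ⟨t0, hH⟩ := hex
  set H := Hmat W (Function.update x v t0) with hHdef
  set g := H⁻¹ v v with hg
  have hg0 : 0 < g := hH.inv.diag_pos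
  set ψ := H⁻¹ *ᵥ η with hψ
  have hψ0 : 0 < ψ v := hpos _ hH
  set u := H⁻¹ *ᵥ Pi.single v 1 with hu
  have huv : u v = g := aux_col _ _ _
  have hHt : ∀ t, Hmat W (Function.update x v t) = H + Matrix.single v v (2 * (t - t0)) :=
    fun t => aux_Hmat_update W x v t t0
  set c : ℝ := 1 / g - 2 * t0 with hc
  set b : ℝ := ψ v / g with hb
  have hb0 : 0 < b := by positivity
  have hs : ∀ t, 1 + 2 * (t - t0) * g = g * (2 * t + c) := by
    intro t; rw [hc]; field_simp; ring
  have hpd : ∀ t, (Hmat W (Function.update x v t)).PosDef ↔ 0 < 2 * t + c := by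
    intro t
    rw [hHt, aux_pd_iff hH, ← hg, hs, mul_pos_iff_of_pos_left hg0]
  have hinv : ∀ t, 0 < 2 * t + c → (Hmat W (Function.update x v t))⁻¹ *ᵥ η
      = ψ - (2 * (t - t0) * ψ v / (g * (2 * t + c))) • u := by
    intro t ht
    rw [hHt, aux_inv_upd hH v _ (by rw [← hg, hs]; positivity), ← hg, hs]
  have hψt : ∀ t, 0 < 2 * t + c → ((Hmat W (Function.update x v t))⁻¹ *ᵥ η) v = b / (2 * t + c) := by
    intro t ht
    rw [hinv t ht]
    simp only [Pi.sub_apply, Pi.smul_apply, smul_eq_mul, huv, hb]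
    have := hs t
    have h2 : 2 * (t - t0) = (2 * t + c) - 1 / g := by rw [hc]; ring
    rw [h2]
    generalize 2 * t + c = s at *
    field_simp
    ring
  have hηu : η ⬝ᵥ u = ψ v := by
    rw [hu, aux_inv_symm hH.inv, ← hψ]; simp
  have hq : ∀ t, 0 < 2 * t + c → η ⬝ᵥ (Hmat W (Function.update x v t))⁻¹ *ᵥ η
      = (η ⬝ᵥ ψ - b ^ 2 * g) + b ^ 2 / (2 * t + c) := by
    intro t ht
    rw [hinv t ht, dotProduct_sub, dotProduct_smul, hηu, smul_eq_mul, hb]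
    have h2 : 2 * (t - t0) = (2 * t + c) - 1 / g := by rw [hc]; ring
    rw [h2]
    generalize 2 * t + c = s at *
    field_simp
    ring
  have h1 : ∀ t, (1 : ι → ℝ) ⬝ᵥ (Hmat W (Function.update x v t)) *ᵥ 1
      = ((1 : ι → ℝ) ⬝ᵥ H *ᵥ 1 - 1 / g) + (2 * t + c) := by
    intro t
    rw [hHt, aux_single_mulVec, dotProduct_add, dotProduct_single]
    simp only [Pi.one_apply, hc]
    ring
  have hd : ∀ t, (Hmat W (Function.update x v t)).det = H.det * g * (2 * t + c) := by
    intro t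
    rw [hHt, aux_det_s13 hH, ← hg, hs]; ring
  set K : ℝ := (2 / Real.pi) ^ ((Fintype.card ι : ℝ) / 2) *
    Real.exp (-(1/2) * (((1 : ι → ℝ) ⬝ᵥ H *ᵥ 1 - 1 / g) + (η ⬝ᵥ ψ - b ^ 2 * g)) + η ⬝ᵥ (1 : ι → ℝ))
      / Real.sqrt (H.det * g) with hK
  have hdens : ∀ t, 0 < 2 * t + c → nuDens W η (Function.update x v t) =
      ENNReal.ofReal (K * Real.exp (-(1/2) * ((2*t+c) + b^2 / (2*t+c))) / Real.sqrt (2*t+c)) := by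
    intro t ht
    rw [nuDens, Set.indicator_of_mem (show Function.update x v t ∈ {β : ι → ℝ | (Hmat W β).PosDef} from (hpd t).2 ht)]
    congr 1
    rw [h1, hq t ht, hd, Real.sqrt_mul (mul_nonneg hH.det_pos.le hg0.le), hK]
    have : Real.exp (-(1 / 2) * (1 ⬝ᵥ H *ᵥ 1 - 1 / g + (2 * t + c) +
        (η ⬝ᵥ ψ - b ^ 2 * g + b ^ 2 / (2 * t + c))) + η ⬝ᵥ 1) =
        Real.exp (-(1/2) * (((1 : ι → ℝ) ⬝ᵥ H *ᵥ 1 - 1 / g) + (η ⬝ᵥ ψ - b ^ 2 * g)) + η ⬝ᵥ (1 : ι → ℝ))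
        * Real.exp (-(1/2) * ((2*t+c) + b^2 / (2*t+c))) := by
      rw [← Real.exp_add]; congr 1; ring
    rw [this, ← mul_assoc, div_mul_eq_mul_div, div_div]
  have hdens0 : ∀ t, ¬ 0 < 2 * t + c → nuDens W η (Function.update x v t) = 0 := by
    intro t ht
    rw [nuDens, Set.indicator_of_notMem]
    exact fun h => ht ((hpd t).1 h)
  have hSm : MeasurableSet {t : ℝ | 0 < 2 * t + c} := measurableSet_lt (by fun_prop) (by fun_prop)
  have key := aux_int b c K hb0
  rw [← lintegral_indicator hSm, ← lintegral_indicator hSm] at key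
  convert key using 1
  · apply lintegral_congr
    intro t
    by_cases ht : 0 < 2 * t + c
    · rw [Set.indicator_of_mem (show t ∈ {t : ℝ | 0 < 2 * t + c} from ht), hψt t ht, hdens t ht]
    · rw [Set.indicator_of_notMem (show t ∉ {t : ℝ | 0 < 2 * t + c} from ht), hdens0 t ht, mul_zero]
  · apply lintegral_congr
    intro t
    by_cases ht : 0 < 2 * t + c
    · rw [Set.indicator_of_mem (show t ∈ {t : ℝ | 0 < 2 * t + c} from ht), hdens t ht]
    · rw [Set.indicator_of_notMem (show t ∉ {t : ℝ | 0 < 2 * t + c} from ht), hdens0 t ht]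

lemma aux_fin_key {ι : Type*} [Fintype ι] [DecidableEq ι] (W : Matrix ι ι ℝ) (η : ι → ℝ) (v : ι)
    (hpos : ∀ β, (Hmat W β).PosDef → 0 < ((Hmat W β)⁻¹ *ᵥ η) v)
    (f : (ι → ℝ) → ENNReal) (hf : Measurable f) (hfv : ∀ x t, f (Function.update x v t) = f x) :
    ∫⁻ β, f β * ENNReal.ofReal (((Hmat W β)⁻¹ *ᵥ η) v) ∂(nuMeas W η) = ∫⁻ β, f β ∂(nuMeas W η) := by
  have hm : Measurable fun β : ι → ℝ => ENNReal.ofReal (((Hmat W β)⁻¹ *ᵥ η) v) :=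
    (aux_inv_mulVec_meas W η v).ennreal_ofReal
  have hd := aux_dens_meas W η
  have hfm : Measurable fun β => f β * ENNReal.ofReal (((Hmat W β)⁻¹ *ᵥ η) v) := hf.mul hm
  rw [nuMeas, lintegral_withDensity_eq_lintegral_mul _ hd hfm,
    lintegral_withDensity_eq_lintegral_mul _ hd hf]
  apply lintegral_eq_of_lmarginal_eq {v} (hd.mul hfm) (hd.mul hf)
  rw [lmarginal_singleton, lmarginal_singleton]
  ext x
  simp only [Pi.mul_apply, hfv]
  have hu : Measurable (fun t : ℝ => Function.update x v t) := measurable_update x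
  calc _ = ∫⁻ t, f x * (ENNReal.ofReal (((Hmat W (Function.update x v t))⁻¹ *ᵥ η) v)
        * nuDens W η (Function.update x v t)) := by
        apply lintegral_congr; intro t; ring
    _ = ∫⁻ t, f x * nuDens W η (Function.update x v t) := by
        have m1 : Measurable fun t : ℝ => nuDens W η (Function.update x v t) := hd.comp hu
        have m2 : Measurable fun t : ℝ =>
            ENNReal.ofReal (((Hmat W (Function.update x v t))⁻¹ *ᵥ η) v)
              * nuDens W η (Function.update x v t) := (hm.comp hu).mul m1
        rw [lintegral_const_mul _ m2, lintegral_const_mul _ m1, aux_one_dim W η v hpos x]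
    _ = _ := by apply lintegral_congr; intro t; ring

/-! ### Restriction to finite sets -/

/-- boundary weight -/
def etaU {V : Type*} [DecidableEq V] (W : V → V → ℝ) (U : Finset V) (i : V) : ℝ :=
  ∑' k : V, if k ∈ U then 0 else W i k

/-- restricted weights -/
def WU {V : Type*} (W : V → V → ℝ) (U : Finset V) : Matrix ↥U ↥U ℝ :=
  Matrix.of fun i j : ↥U => W i.1 j.1

/-- `ψ` as a function of the restricted potential -/
def phi {V : Type*} [DecidableEq V] (W : V → V → ℝ) (U : Finset V) (b : ↥U → ℝ) : ↥U → ℝ :=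
  (Hmat (WU W U) b)⁻¹ *ᵥ (fun i : ↥U => etaU W U i.1)

/-- restriction map -/
def restr {V : Type*} (U : Finset V) (β : V → ℝ) : ↥U → ℝ := fun i => β i.1

/-- `ψ` of a finite set -/
def psiU {V : Type*} [DecidableEq V] (W : V → V → ℝ) (U : Finset V) (i : V) (β : V → ℝ) : ℝ :=
  if h : i ∈ U then phi W U (restr U β) ⟨i, h⟩ else 0

lemma psiSeq_eq {V : Type*} [DecidableEq V] (W : V → V → ℝ) (Vseq : ℕ → Finset V)
    (n : ℕ) (i : V) : psiSeq W Vseq n i = psiU W (Vseq n) i := rfl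

lemma eta_summable {V : Type*} [DecidableEq V] {W : V → V → ℝ} (hnn : ∀ i j, 0 ≤ W i j)
    (hloc : ∀ i, {j | 0 < W i j}.Finite) (U : Finset V) (i : V) :
    Summable (fun k : V => if k ∈ U then 0 else W i k) := by
  apply summable_of_hasFiniteSupport
  apply (hloc i).subset
  intro k hk
  simp only [Function.mem_support] at hk
  have : W i k ≠ 0 := by
    intro h; apply hk; simp [h]
  exact lt_of_le_of_ne (hnn i k) (Ne.symm this)

lemma eta_nonneg {V : Type*} [DecidableEq V] {W : V → V → ℝ} (hnn : ∀ i j, 0 ≤ W i j)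
    (U : Finset V) (i : V) : 0 ≤ etaU W U i := by
  apply tsum_nonneg
  intro k
  split_ifs
  · exact le_rfl
  · exact hnn i k

lemma eta_pos {V : Type*} [DecidableEq V] {W : V → V → ℝ} (hnn : ∀ i j, 0 ≤ W i j)
    (hloc : ∀ i, {j | 0 < W i j}.Finite) (U : Finset V) (i k : V) (hk : k ∉ U) (hW : 0 < W i k) :
    0 < etaU W U i := by
  apply (eta_summable hnn hloc U i).tsum_pos _ k
  · simpa [hk] using hW
  · intro k
    split_ifs
    · exact le_rfl
    · exact hnn i k

lemma eta_zero {V : Type*} [DecidableEq V] {W : V → V → ℝ} (hnn : ∀ i j, 0 ≤ W i j)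
    (U : Finset V) (i : V) (h : ∀ k, 0 < W i k → k ∈ U) : etaU W U i = 0 := by
  have : (fun k : V => if k ∈ U then 0 else W i k) = fun _ => 0 := by
    ext k
    split_ifs with hk
    · rfl
    · by_contra h0
      exact hk (h k (lt_of_le_of_ne (hnn i k) (Ne.symm h0)))
  rw [etaU, this, tsum_zero]

lemma eta_insert {V : Type*} [DecidableEq V] {W : V → V → ℝ} (hnn : ∀ i j, 0 ≤ W i j)
    (hloc : ∀ i, {j | 0 < W i j}.Finite) (U : Finset V) (i v : V) (hv : v ∉ U) :
    etaU W U i = etaU W (insert v U) i + W i v := by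
  have h1 : (fun k : V => if k ∈ U then 0 else W i k) =
      fun k => (if k ∈ insert v U then 0 else W i k) + (if k = v then W i v else 0) := by
    ext k
    by_cases hk : k = v
    · subst hk; simp [hv]
    · simp [hk]
  have h2 : HasSum (fun k => if k = v then W i v else 0) (W i v) := hasSum_ite_eq v (W i v)
  rw [etaU, h1, (eta_summable hnn hloc (insert v U) i).tsum_add h2.summable, h2.tsum_eq]
  rfl

lemma off_diag {V : Type*} [DecidableEq V] {W : V → V → ℝ} (hnn : ∀ i j, 0 ≤ W i j)
    (U : Finset V) (b : ↥U → ℝ) (i j : ↥U) (hij : i ≠ j) : Hmat (WU W U) b i j ≤ 0 := by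
  simp only [Hmat, WU, Matrix.sub_apply, Matrix.smul_apply, Matrix.diagonal_apply, Matrix.of_apply]
  simp [hij, hnn]

lemma row_eq {V : Type*} [DecidableEq V] (W : V → V → ℝ)
    (U : Finset V) (b : ↥U → ℝ) (x : ↥U → ℝ) (i : ↥U) :
    (Hmat (WU W U) b *ᵥ x) i = 2 * b i * x i - ∑ j : ↥U, W i.1 j.1 * x j := by
  rw [Hmat, Matrix.sub_mulVec, Pi.sub_apply]
  congr 1
  rw [Matrix.smul_mulVec, Pi.smul_apply, Matrix.mulVec_diagonal]
  simp [mul_assoc]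

lemma phi_nonneg {V : Type*} [DecidableEq V] {W : V → V → ℝ} (hnn : ∀ i j, 0 ≤ W i j)
    (U : Finset V) (b : ↥U → ℝ) (hb : (Hmat (WU W U) b).PosDef) (i : ↥U) : 0 ≤ phi W U b i := by
  apply aux_nonneg hb (off_diag hnn U b)
  intro j
  rw [phi, aux_inv_mulVec hb]
  exact eta_nonneg hnn U j.1

lemma phi_row {V : Type*} [DecidableEq V] {W : V → V → ℝ}
    (U : Finset V) (b : ↥U → ℝ) (hb : (Hmat (WU W U) b).PosDef) (i : ↥U) :
    2 * b i * phi W U b i - ∑ j : ↥U, W i.1 j.1 * phi W U b j = etaU W U i.1 := by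
  rw [← row_eq, phi, aux_inv_mulVec hb]

lemma phi_pos {V : Type*} [Infinite V] [DecidableEq V] {W : V → V → ℝ}
    (hsymm : ∀ i j, W i j = W j i) (hnn : ∀ i j, 0 ≤ W i j)
    (hloc : ∀ i, {j | 0 < W i j}.Finite)
    (hconn : (SimpleGraph.fromRel fun i j => 0 < W i j).Connected)
    (U : Finset V) (b : ↥U → ℝ) (hb : (Hmat (WU W U) b).PosDef) (v : ↥U) : 0 < phi W U b v := by
  apply lt_of_le_of_ne (phi_nonneg hnn U b hb v)
  intro h0
  have key : ∀ k : V, ∃ h : k ∈ U, phi W U b ⟨k, h⟩ = 0 := by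
    intro k
    have hr := hconn.preconnected v.1 k
    rw [SimpleGraph.reachable_iff_reflTransGen] at hr
    induction hr with
    | refl => exact ⟨v.2, h0.symm⟩
    | @tail k l _ hkl ih =>
      obtain ⟨hk, hk0⟩ := ih
      have hW : 0 < W k l := by
        rw [SimpleGraph.fromRel_adj] at hkl
        rcases hkl.2 with h | h
        · exact h
        · rw [hsymm]; exact h
      have hrow := phi_row U b hb ⟨k, hk⟩
      rw [hk0, mul_zero, zero_sub] at hrow
      have hnn' : ∀ j ∈ (Finset.univ : Finset ↥U), 0 ≤ W k j.1 * phi W U b j :=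
        fun j _ => mul_nonneg (hnn _ _) (phi_nonneg hnn U b hb j)
      have hs := Finset.sum_nonneg hnn'
      have he := eta_nonneg hnn U k
      have hl : l ∈ U := by
        by_contra hl
        have := eta_pos hnn hloc U k l hl hW
        simp only at hrow
        linarith
      refine ⟨hl, ?_⟩
      have hs0 : ∑ j : ↥U, W k j.1 * phi W U b j = 0 := by
        simp only at hrow
        linarith
      have := (Finset.sum_eq_zero_iff_of_nonneg hnn').1 hs0 ⟨l, hl⟩ (Finset.mem_univ _)
      exact (mul_eq_zero.1 this).resolve_left hW.ne'
  obtain ⟨k, hk⟩ := Infinite.exists_notMem_finset U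
  exact hk (key k).1

/-- auxiliary vector -/
def gvec {V : Type*} [DecidableEq V] (W : V → V → ℝ) (U : Finset V) (v : V) (b : ↥U → ℝ) : ↥U → ℝ :=
  (Hmat (WU W U) b)⁻¹ *ᵥ (fun i : ↥U => W i.1 v)

lemma pd_sub {V : Type*} [DecidableEq V] {W : V → V → ℝ}
    {U U' : Finset V} (hU : U ⊆ U') (β : V → ℝ)
    (hb : (Hmat (WU W U') (restr U' β)).PosDef) : (Hmat (WU W U) (restr U β)).PosDef := by
  have h := hb.submatrix (e := fun i : ↥U => (⟨i.1, hU i.2⟩ : ↥U'))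
    (fun i j h => by
      have := congrArg Subtype.val h
      exact Subtype.ext this)
  convert h using 1
  ext i j
  simp only [Hmat, WU, restr, Matrix.submatrix_apply, Matrix.sub_apply, Matrix.smul_apply,
    Matrix.diagonal_apply, Matrix.of_apply, Subtype.ext_iff]

lemma gvec_nonneg {V : Type*} [DecidableEq V] {W : V → V → ℝ} (hnn : ∀ i j, 0 ≤ W i j)
    (U : Finset V) (v : V) (b : ↥U → ℝ) (hb : (Hmat (WU W U) b).PosDef) (i : ↥U) :
    0 ≤ gvec W U v b i := by
  apply aux_nonneg hb (off_diag hnn U b)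
  intro j
  rw [gvec, aux_inv_mulVec hb]
  exact hnn _ _

lemma step_eq {V : Type*} [DecidableEq V] {W : V → V → ℝ} (hnn : ∀ i j, 0 ≤ W i j)
    (hloc : ∀ i, {j | 0 < W i j}.Finite)
    (U : Finset V) (v : V) (hv : v ∉ U) (β : V → ℝ)
    (hb : (Hmat (WU W (insert v U)) (restr (insert v U) β)).PosDef) (i : ↥U) :
    psiU W (insert v U) i.1 β + gvec W U v (restr U β) i =
      psiU W U i.1 β + gvec W U v (restr U β) i * psiU W (insert v U) v β ∧
    gvec W U v (restr U β) i * psiU W (insert v U) v β ≤ psiU W (insert v U) i.1 β := by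
  have hbU := pd_sub (Finset.subset_insert v U) β hb
  set p := psiU W (insert v U) v β with hp
  set ζ : ↥U → ℝ := (Hmat (WU W U) (restr U β))⁻¹ *ᵥ (fun i : ↥U => etaU W (insert v U) i.1) with hζ
  have hζ0 : ∀ i, 0 ≤ ζ i := by
    apply aux_nonneg hbU (off_diag hnn U _)
    intro j
    rw [hζ, aux_inv_mulVec hbU]
    exact eta_nonneg hnn _ _
  have e1 : (Hmat (WU W U) (restr U β))⁻¹ *ᵥ
      ((fun i : ↥U => etaU W (insert v U) i.1) + p • (fun i : ↥U => W i.1 v))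
      = fun i : ↥U => psiU W (insert v U) i.1 β := by
    apply aux_inv_eq hbU
    ext j
    rw [row_eq]
    have hj : j.1 ∈ insert v U := Finset.mem_insert_of_mem j.2
    have := phi_row (insert v U) _ hb ⟨j.1, hj⟩
    have hpsi : ∀ k (hk : k ∈ insert v U),
        phi W (insert v U) (restr (insert v U) β) ⟨k, hk⟩ = psiU W (insert v U) k β := by
      intro k hk; simp [psiU, hk]
    have hsum : ∑ k : ↥(insert v U), W j.1 k.1 * phi W (insert v U) (restr (insert v U) β) k
        = W j.1 v * p + ∑ k : ↥U, W j.1 k.1 * psiU W (insert v U) k.1 β := by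
      calc _ = ∑ k : ↥(insert v U), W j.1 k.1 * psiU W (insert v U) k.1 β := by
            apply Finset.sum_congr rfl
            intro k _
            rw [← hpsi k.1 k.2]
        _ = _ := by
            rw [Finset.sum_coe_sort (insert v U) (fun k => W j.1 k * psiU W (insert v U) k β),
              Finset.sum_insert hv, Finset.sum_coe_sort U (fun k => W j.1 k * psiU W (insert v U) k β)]
    rw [hsum, hpsi] at this
    simp only [Pi.add_apply, Pi.smul_apply, smul_eq_mul, restr] at this ⊢
    linarith
  have e2 : phi W U (restr U β) = ζ + gvec W U v (restr U β) := by
    rw [phi, gvec, hζ, ← Matrix.mulVec_add]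
    congr 1
    ext j
    exact eta_insert hnn hloc U j.1 v hv
  have e3 : psiU W U i.1 β = ζ i + gvec W U v (restr U β) i := by
    have : psiU W U i.1 β = phi W U (restr U β) i := by simp [psiU]
    rw [this, e2]; rfl
  have e4 : psiU W (insert v U) i.1 β = ζ i + p * gvec W U v (restr U β) i := by
    rw [← congrFun e1 i, Matrix.mulVec_add, Matrix.mulVec_smul]
    rfl
  constructor
  · rw [e3, e4]; ring
  · rw [e4]
    have := hζ0 i
    linarith

/-! ### Integration against `ν` -/

lemma restr_meas {V : Type*} (U : Finset V) : Measurable (restr U) :=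
  measurable_pi_lambda _ fun i => measurable_pi_apply i.1

lemma hnu {V : Type*} [DecidableEq V] {W : V → V → ℝ} {ν : Measure (V → ℝ)}
    (hν : RestrictionProp W ν) (U : Finset V) (hU : U.Nonempty) :
    Measure.map (restr U) ν = nuMeas (WU W U) (fun i : ↥U => etaU W U i.1) := hν U hU

lemma ae_pd {V : Type*} [DecidableEq V] {W : V → V → ℝ} {ν : Measure (V → ℝ)}
    (hν : RestrictionProp W ν) (U : Finset V) (hU : U.Nonempty) :
    ∀ᵐ β ∂ν, (Hmat (WU W U) (restr U β)).PosDef := by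
  have h : ∀ᵐ b ∂(Measure.map (restr U) ν), (Hmat (WU W U) b).PosDef := by
    rw [hnu hν U hU, nuMeas, ae_withDensity_iff (aux_dens_meas _ _)]
    filter_upwards with b hb
    by_contra hn
    apply hb
    rw [nuDens, Set.indicator_of_notMem]
    exact hn
  exact ae_of_ae_map (restr_meas U).aemeasurable h

lemma phi_meas {V : Type*} [DecidableEq V] (W : V → V → ℝ) (U : Finset V) (i : ↥U) :
    Measurable (fun b => phi W U b i) := aux_inv_mulVec_meas _ _ _

lemma gvec_meas {V : Type*} [DecidableEq V] (W : V → V → ℝ) (U : Finset V) (v : V) (i : ↥U) :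
    Measurable (fun b => gvec W U v b i) := aux_inv_mulVec_meas _ _ _

lemma psiU_comp {V : Type*} [DecidableEq V] (W : V → V → ℝ) (U : Finset V) (i : V) (hi : i ∈ U) :
    psiU W U i = (fun b => phi W U b ⟨i, hi⟩) ∘ restr U := by
  ext β; simp [psiU, hi]

lemma psiU_meas {V : Type*} [DecidableEq V] (W : V → V → ℝ) (U : Finset V) (i : V) :
    Measurable (psiU W U i) := by
  by_cases hi : i ∈ U
  · rw [psiU_comp W U i hi]
    exact (phi_meas W U _).comp (restr_meas U)
  · have : psiU W U i = fun _ => 0 := by ext β; simp [psiU, hi]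
    rw [this]; exact measurable_const

lemma psiU_nonneg {V : Type*} [DecidableEq V] {W : V → V → ℝ} (hnn : ∀ i j, 0 ≤ W i j)
    {ν : Measure (V → ℝ)} (hν : RestrictionProp W ν) (U : Finset V) (i : V) :
    ∀ᵐ β ∂ν, 0 ≤ psiU W U i β := by
  by_cases hi : i ∈ U
  · filter_upwards [ae_pd hν U ⟨i, hi⟩] with β hβ
    rw [psiU_comp W U i hi]
    exact phi_nonneg hnn U _ hβ _
  · filter_upwards with β
    simp [psiU, hi]

section
variable {V : Type*} [Infinite V] [DecidableEq V] {W : V → V → ℝ}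
    {ν : Measure (V → ℝ)}

lemma key_nu (hsymm : ∀ i j, W i j = W j i) (hnn : ∀ i j, 0 ≤ W i j)
    (hloc : ∀ i, {j | 0 < W i j}.Finite)
    (hconn : (SimpleGraph.fromRel fun i j => 0 < W i j).Connected)
    (hν : RestrictionProp W ν) (U : Finset V) (v : V) (hv : v ∉ U)
    (f : (↥U → ℝ) → ENNReal) (hf : Measurable f) :
    ∫⁻ β, f (restr U β) * ENNReal.ofReal (psiU W (insert v U) v β) ∂ν
      = ∫⁻ β, f (restr U β) ∂ν := by
  have hvm : v ∈ insert v U := Finset.mem_insert_self v U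
  set R : (↥(insert v U) → ℝ) → (↥U → ℝ) :=
    fun b i => b ⟨i.1, Finset.mem_insert_of_mem i.2⟩ with hR
  have hRm : Measurable R := measurable_pi_lambda _ fun i => measurable_pi_apply _
  have hRr : ∀ β, R (restr (insert v U) β) = restr U β := fun β => rfl
  have hfR : Measurable (fun b => f (R b)) := hf.comp hRm
  have key := aux_fin_key (WU W (insert v U)) (fun i => etaU W (insert v U) i.1) ⟨v, hvm⟩
    (fun b hb => phi_pos hsymm hnn hloc hconn (insert v U) b hb _) (fun b => f (R b)) hfR
    (by
      intro x t
      congr 1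
      ext i
      simp only [hR]
      rw [Function.update_of_ne]
      intro h
      have := congrArg Subtype.val h
      simp only at this
      exact hv (this ▸ i.2))
  rw [← hnu hν (insert v U) ⟨v, hvm⟩, lintegral_map _ (restr_meas _),
    lintegral_map hfR (restr_meas _)] at key
  · refine Eq.trans ?_ key
    apply lintegral_congr
    intro β
    rw [psiU_comp W _ v hvm]
    rfl
  · exact hfR.mul (phi_meas W (insert v U) ⟨v, hvm⟩).ennreal_ofReal

lemma lint_one (hsymm : ∀ i j, W i j = W j i) (hnn : ∀ i j, 0 ≤ W i j)
    (hloc : ∀ i, {j | 0 < W i j}.Finite)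
    (hconn : (SimpleGraph.fromRel fun i j => 0 < W i j).Connected)
    (hprob : IsProbabilityMeasure ν)
    (hν : RestrictionProp W ν) (U : Finset V) (i : V) (hi : i ∈ U) :
    ∫⁻ β, ENNReal.ofReal (psiU W U i β) ∂ν = 1 := by
  have := key_nu hsymm hnn hloc hconn hν (U.erase i) i (Finset.notMem_erase i U)
    (fun _ => 1) measurable_const
  rw [Finset.insert_erase hi] at this
  simpa using this

lemma psi_integrable (hsymm : ∀ i j, W i j = W j i) (hnn : ∀ i j, 0 ≤ W i j)
    (hloc : ∀ i, {j | 0 < W i j}.Finite)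
    (hconn : (SimpleGraph.fromRel fun i j => 0 < W i j).Connected)
    (hprob : IsProbabilityMeasure ν)
    (hν : RestrictionProp W ν) (U : Finset V) (i : V) (hi : i ∈ U) :
    Integrable (psiU W U i) ν := by
  refine ⟨(psiU_meas W U i).aestronglyMeasurable, ?_⟩
  rw [hasFiniteIntegral_iff_ofReal (psiU_nonneg hnn hν U i),
    lint_one hsymm hnn hloc hconn hprob hν U i hi]
  exact ENNReal.one_lt_top

/-- the sigma-algebra of a finite set -/
abbrev sigU {V : Type*} (U : Finset V) : MeasurableSpace (V → ℝ) :=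
  MeasurableSpace.comap (restr U) inferInstance

lemma sigU_le {V : Type*} (U : Finset V) : sigU U ≤ (inferInstance : MeasurableSpace (V → ℝ)) :=
  (restr_meas U).comap_le

lemma sigU_mono {V : Type*} {U U' : Finset V} (h : U ⊆ U') : sigU U ≤ sigU U' := by
  have hRm : Measurable (fun (b : ↥U' → ℝ) (i : ↥U) => b ⟨i.1, h i.2⟩) :=
    measurable_pi_lambda _ fun i => measurable_pi_apply _
  rintro s ⟨B, hB, rfl⟩
  exact ⟨_, hRm hB, rfl⟩

lemma step_int (hsymm : ∀ i j, W i j = W j i) (hnn : ∀ i j, 0 ≤ W i j)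
    (hloc : ∀ i, {j | 0 < W i j}.Finite)
    (hconn : (SimpleGraph.fromRel fun i j => 0 < W i j).Connected)
    (hprob : IsProbabilityMeasure ν)
    (hν : RestrictionProp W ν) (U : Finset V) (v : V) (hv : v ∉ U) (i : V) (hi : i ∈ U)
    (A : Set (V → ℝ)) (hA : MeasurableSet[sigU U] A) :
    ∫⁻ β in A, ENNReal.ofReal (psiU W (insert v U) i β) ∂ν
      = ∫⁻ β in A, ENNReal.ofReal (psiU W U i β) ∂ν := by
  have hAm : MeasurableSet A := sigU_le U A hA
  obtain ⟨B, hB, rfl⟩ := hA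
  set g : (V → ℝ) → ℝ := fun β => gvec W U v (restr U β) ⟨i, hi⟩ with hg
  have hgm : Measurable g := (gvec_meas W U v ⟨i, hi⟩).comp (restr_meas U)
  have hpdae := ae_pd hν (insert v U) ⟨v, Finset.mem_insert_self v U⟩
  have hgB : ∫⁻ β in restr U ⁻¹' B,
        ENNReal.ofReal (g β) * ENNReal.ofReal (psiU W (insert v U) v β) ∂ν
      = ∫⁻ β in restr U ⁻¹' B, ENNReal.ofReal (g β) ∂ν := by
    have := key_nu hsymm hnn hloc hconn hν U v hv
      (B.indicator fun b => ENNReal.ofReal (gvec W U v b ⟨i, hi⟩))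
      ((gvec_meas W U v ⟨i, hi⟩).ennreal_ofReal.indicator hB)
    rw [← lintegral_indicator hAm, ← lintegral_indicator hAm]
    refine Eq.trans ?_ (this.trans ?_)
    · apply lintegral_congr
      intro β
      by_cases hβ : restr U β ∈ B
      · rw [Set.indicator_of_mem (show β ∈ restr U ⁻¹' B from hβ), Set.indicator_of_mem hβ]
      · rw [Set.indicator_of_notMem (show β ∉ restr U ⁻¹' B from hβ), Set.indicator_of_notMem hβ,
          zero_mul]
    · apply lintegral_congr
      intro β
      by_cases hβ : restr U β ∈ B
      · rw [Set.indicator_of_mem (show β ∈ restr U ⁻¹' B from hβ), Set.indicator_of_mem hβ]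
      · rw [Set.indicator_of_notMem (show β ∉ restr U ⁻¹' B from hβ), Set.indicator_of_notMem hβ]
  have hfin : ∫⁻ β in restr U ⁻¹' B, ENNReal.ofReal (g β) ∂ν ≠ ⊤ := by
    rw [← hgB]
    apply ne_of_lt
    calc _ ≤ ∫⁻ β in restr U ⁻¹' B, ENNReal.ofReal (psiU W (insert v U) i β) ∂ν := by
          apply lintegral_mono_ae
          apply ae_restrict_of_ae
          filter_upwards [hpdae] with β hβ
          have hbU := pd_sub (Finset.subset_insert v U) β hβ
          rw [← ENNReal.ofReal_mul (gvec_nonneg hnn U v _ hbU _)]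
          exact ENNReal.ofReal_le_ofReal (step_eq hnn hloc U v hv β hβ ⟨i, hi⟩).2
      _ ≤ ∫⁻ β, ENNReal.ofReal (psiU W (insert v U) i β) ∂ν := setLIntegral_le_lintegral _ _
      _ = 1 := lint_one hsymm hnn hloc hconn hprob hν _ i (Finset.mem_insert_of_mem hi)
      _ < ⊤ := ENNReal.one_lt_top
  have hadd : ∫⁻ β in restr U ⁻¹' B,
        (ENNReal.ofReal (psiU W (insert v U) i β) + ENNReal.ofReal (g β)) ∂ν
      = ∫⁻ β in restr U ⁻¹' B, (ENNReal.ofReal (psiU W U i β)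
          + ENNReal.ofReal (g β) * ENNReal.ofReal (psiU W (insert v U) v β)) ∂ν := by
    apply lintegral_congr_ae
    apply ae_restrict_of_ae
    filter_upwards [hpdae, psiU_nonneg hnn hν (insert v U) i, psiU_nonneg hnn hν (insert v U) v,
      psiU_nonneg hnn hν U i] with β hβ h1 h2 h3
    have hbU := pd_sub (Finset.subset_insert v U) β hβ
    have hg0 : 0 ≤ g β := gvec_nonneg hnn U v _ hbU _
    rw [← ENNReal.ofReal_mul hg0, ← ENNReal.ofReal_add h1 hg0,
      ← ENNReal.ofReal_add h3 (mul_nonneg hg0 h2)]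
    congr 1
    exact (step_eq hnn hloc U v hv β hβ ⟨i, hi⟩).1
  rw [lintegral_add_right _ hgm.ennreal_ofReal,
    lintegral_add_left (psiU_meas W U i).ennreal_ofReal, hgB] at hadd
  exact (ENNReal.add_left_inj hfin).1 hadd

lemma tower_int (hsymm : ∀ i j, W i j = W j i) (hnn : ∀ i j, 0 ≤ W i j)
    (hloc : ∀ i, {j | 0 < W i j}.Finite)
    (hconn : (SimpleGraph.fromRel fun i j => 0 < W i j).Connected)
    (hprob : IsProbabilityMeasure ν)
    (hν : RestrictionProp W ν) (U T : Finset V) (i : V) (hi : i ∈ U)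
    (A : Set (V → ℝ)) (hA : MeasurableSet[sigU U] A) :
    ∫⁻ β in A, ENNReal.ofReal (psiU W (U ∪ T) i β) ∂ν
      = ∫⁻ β in A, ENNReal.ofReal (psiU W U i β) ∂ν := by
  induction T using Finset.induction with
  | empty => rw [Finset.union_empty]
  | insert a T ha ih =>
    rw [Finset.union_insert]
    by_cases h : a ∈ U ∪ T
    · rw [Finset.insert_eq_of_mem h, ih]
    · rw [step_int hsymm hnn hloc hconn hprob hν (U ∪ T) a h i (Finset.mem_union_left _ hi) A
        (sigU_mono Finset.subset_union_left A hA), ih]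

lemma condExp_eq (hsymm : ∀ i j, W i j = W j i) (hnn : ∀ i j, 0 ≤ W i j)
    (hloc : ∀ i, {j | 0 < W i j}.Finite)
    (hconn : (SimpleGraph.fromRel fun i j => 0 < W i j).Connected)
    (hprob : IsProbabilityMeasure ν)
    (hν : RestrictionProp W ν) (U U' : Finset V) (hUU : U ⊆ U') (i : V) (hi : i ∈ U) :
    psiU W U i =ᵐ[ν] ν[psiU W U' i | sigU U] := by
  have hpsiInt := psi_integrable hsymm hnn hloc hconn hprob hν
  apply ae_eq_condExp_of_forall_setIntegral_eq (sigU_le U) (hpsiInt U' i (hUU hi))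
  · intro s _ _
    exact (hpsiInt U i hi).integrableOn
  · intro s hs _
    have h := tower_int hsymm hnn hloc hconn hprob hν U U' i hi s hs
    rw [Finset.union_eq_right.2 hUU] at h
    rw [integral_eq_lintegral_of_nonneg_ae (ae_restrict_of_ae (psiU_nonneg hnn hν U i))
        (psiU_meas W U i).aestronglyMeasurable,
      integral_eq_lintegral_of_nonneg_ae (ae_restrict_of_ae (psiU_nonneg hnn hν U' i))
        (psiU_meas W U' i).aestronglyMeasurable, h]
  · apply Measurable.aestronglyMeasurable
    rw [psiU_comp W U i hi]
    exact (phi_meas W U _).comp (comap_measurable _)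

end

theorem stmt13 {V : Type*} [Countable V] [Infinite V] [DecidableEq V]
    (W : V → V → ℝ) (hsymm : ∀ i j, W i j = W j i) (hnn : ∀ i j, 0 ≤ W i j)
    (hdiag : ∀ i, W i i = 0) (hloc : ∀ i, {j | 0 < W i j}.Finite)
    (hconn : (SimpleGraph.fromRel fun i j => 0 < W i j).Connected)
    (ν : Measure (V → ℝ)) (hprob : IsProbabilityMeasure ν) (hν : RestrictionProp W ν)
    (Vseq : ℕ → Finset V) (hmono : Monotone Vseq) (hne : ∀ n, (Vseq n).Nonempty)
    (hconn' : ∀ n, ((SimpleGraph.fromRel fun i j => 0 < W i j).induce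
        (↑(Vseq n) : Set V)).Connected)
    (hexh : ∀ i : V, ∃ n, i ∈ Vseq n) :
    (∀ i : V, ∀ n : ℕ, i ∈ Vseq n →
        (∀ᵐ β ∂ν, 0 ≤ psiSeq W Vseq n i β) ∧
        Measurable[filtr Vseq n] (psiSeq W Vseq n i) ∧
        Integrable (psiSeq W Vseq n i) ν ∧
        ν[psiSeq W Vseq (n + 1) i|filtr Vseq n] =ᵐ[ν] psiSeq W Vseq n i) ∧
      ∃ ψ : V → (V → ℝ) → ℝ, (∀ i, Integrable (ψ i) ν) ∧
        ∀ᵐ β ∂ν,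
          (∀ i, Filter.Tendsto (fun n => psiSeq W Vseq n i β) Filter.atTop (nhds (ψ i β))) ∧
          ∀ i, 2 * β i * ψ i β = ∑' j : V, W i j * ψ j β := by
  have hpsiInt := fun U i => psi_integrable (ν := ν) hsymm hnn hloc hconn hprob hν U i
  have hmeas : ∀ U i, i ∈ U → Measurable[sigU U] (psiU W U i) := by
    intro U i hi
    rw [psiU_comp W U i hi]
    exact (phi_meas W U _).comp (comap_measurable _)
  refine ⟨?_, ?_⟩
  · intro i n hi
    simp only [psiSeq_eq]
    refine ⟨psiU_nonneg hnn hν _ i, hmeas _ i hi, hpsiInt _ i hi, ?_⟩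
    exact (condExp_eq hsymm hnn hloc hconn hprob hν _ _ (hmono (Nat.le_succ n)) i hi).symm
  · have hconv : ∀ i, ∃ ψ : (V → ℝ) → ℝ, Integrable ψ ν ∧
        ∀ᵐ β ∂ν, Filter.Tendsto (fun n => psiSeq W Vseq n i β) Filter.atTop (nhds (ψ β)) := by
      intro i
      obtain ⟨n0, hn0⟩ := hexh i
      have hmem : ∀ k, i ∈ Vseq (k + n0) := fun k => hmono (Nat.le_add_left n0 k) hn0
      let ℱ : Filtration ℕ (inferInstance : MeasurableSpace (V → ℝ)) :=
        { seq := fun k => sigU (Vseq (k + n0))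
          mono' := fun a b hab => sigU_mono (hmono (Nat.add_le_add_right hab n0))
          le' := fun k => sigU_le _ }
      have hmart : Martingale (fun k => psiU W (Vseq (k + n0)) i) ℱ ν := by
        apply martingale_nat
        · intro k
          exact (hmeas _ i (hmem k)).stronglyMeasurable
        · intro k
          exact hpsiInt _ i (hmem k)
        · intro k
          exact condExp_eq hsymm hnn hloc hconn hprob hν _ _
            (hmono (Nat.add_le_add_right (Nat.le_succ k) n0)) i (hmem k)
      have hbd : ∀ k, eLpNorm (psiU W (Vseq (k + n0)) i) 1 ν ≤ ((1 : NNReal) : ENNReal) := by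
        intro k
        rw [eLpNorm_one_eq_lintegral_enorm]
        have : ∫⁻ β, ‖psiU W (Vseq (k + n0)) i β‖ₑ ∂ν
            = ∫⁻ β, ENNReal.ofReal (psiU W (Vseq (k + n0)) i β) ∂ν := by
          apply lintegral_congr_ae
          filter_upwards [psiU_nonneg hnn hν (Vseq (k + n0)) i] with β hβ
          exact Real.enorm_of_nonneg hβ
        rw [this, lint_one hsymm hnn hloc hconn hprob hν _ i (hmem k)]
        simp
      refine ⟨Filtration.limitProcess (fun k => psiU W (Vseq (k + n0)) i) ℱ ν,
        memLp_one_iff_integrable.1 (hmart.submartingale.memLp_limitProcess hbd), ?_⟩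
      filter_upwards [hmart.submartingale.ae_tendsto_limitProcess hbd] with β hβ
      exact (Filter.tendsto_add_atTop_iff_nat (f := fun n => psiSeq W Vseq n i β) n0).1 hβ
    choose ψ hψi hψt using hconv
    refine ⟨ψ, hψi, ?_⟩
    have hpd : ∀ᵐ β ∂ν, ∀ n, (Hmat (WU W (Vseq n)) (restr (Vseq n) β)).PosDef :=
      ae_all_iff.2 fun n => ae_pd hν _ (hne n)
    filter_upwards [ae_all_iff.2 hψt, hpd] with β hβ hβpd
    refine ⟨hβ, ?_⟩
    intro i
    set N : Finset V := (hloc i).toFinset with hN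
    have hsub : ∃ n, insert i N ⊆ Vseq n := by
      choose m hm using hexh
      refine ⟨(insert i N).sup m, ?_⟩
      intro k hk
      exact hmono (Finset.le_sup hk) (hm k)
    obtain ⟨n0, hn0⟩ := hsub
    have hW0 : ∀ k, k ∉ N → W i k = 0 := by
      intro k hk
      by_contra h
      apply hk
      rw [hN, Set.Finite.mem_toFinset]
      exact lt_of_le_of_ne (hnn i k) (Ne.symm h)
    rw [tsum_eq_sum (s := N) (fun k hk => by rw [hW0 k hk, zero_mul])]
    have t1 : Filter.Tendsto (fun n => 2 * β i * psiSeq W Vseq n i β) Filter.atTop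
        (nhds (2 * β i * ψ i β)) := (hβ i).const_mul _
    have t2 : Filter.Tendsto (fun n => ∑ j ∈ N, W i j * psiSeq W Vseq n j β) Filter.atTop
        (nhds (∑ j ∈ N, W i j * ψ j β)) := tendsto_finsetSum _ fun j _ => (hβ j).const_mul _
    refine tendsto_nhds_unique (t1.congr' ?_) t2
    filter_upwards [Filter.eventually_ge_atTop n0] with n hn
    have hsub : insert i N ⊆ Vseq n := hn0.trans (hmono hn)
    have hi : i ∈ Vseq n := hsub (Finset.mem_insert_self _ _)
    have hrow := phi_row (Vseq n) _ (hβpd n) ⟨i, hi⟩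
    rw [eta_zero hnn (Vseq n) i (fun k hk => hsub (Finset.mem_insert_of_mem (by
      rw [hN, Set.Finite.mem_toFinset]; exact hk)))] at hrow
    have hpsi : ∀ k (hk : k ∈ Vseq n),
        phi W (Vseq n) (restr (Vseq n) β) ⟨k, hk⟩ = psiSeq W Vseq n k β := by
      intro k hk; rw [psiSeq_eq]; simp [psiU, hk]
    have hsum : ∑ k : ↥(Vseq n), W i k.1 * phi W (Vseq n) (restr (Vseq n) β) k
        = ∑ j ∈ N, W i j * psiSeq W Vseq n j β := by
      calc _ = ∑ k : ↥(Vseq n), W i k.1 * psiSeq W Vseq n k.1 β := by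
            apply Finset.sum_congr rfl
            intro k _
            rw [← hpsi k.1 k.2]
        _ = ∑ k ∈ Vseq n, W i k * psiSeq W Vseq n k β :=
            Finset.sum_coe_sort (Vseq n) (fun k => W i k * psiSeq W Vseq n k β)
        _ = _ := by
            symm
            apply Finset.sum_subset ((Finset.subset_insert i N).trans hsub)
            intro k _ hk
            rw [hW0 k hk, zero_mul]
    rw [hsum, hpsi] at hrow
    simp only [restr] at hrow
    linarith

end
end

section
/- Let η ∈ [0,∞)^V. The pushforward of ν_V^W under β ↦ ⟨η, H_β^{-1} η⟩ equals the pushforward of the Gamma(1/2,1) distribution (the measure on ℝ with density γ ↦ 1_{γ>0}·e^{−γ}/√(πγ)) under γ ↦ ⟨η,1⟩²/(2γ). -/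
open MeasureTheory Matrix

noncomputable section

theorem ext_moments (μ ν : Measure ℝ) [IsFiniteMeasure μ] [IsFiniteMeasure ν]
    (hμ : ∀ᵐ y ∂μ, |y| ≤ 1) (hν : ∀ᵐ y ∂ν, |y| ≤ 1)
    (h : ∀ n : ℕ, ∫ y, y ^ n ∂μ = ∫ y, y ^ n ∂ν) : μ = ν := by
  have key : ∀ (ρ : Measure ℝ) [IsFiniteMeasure ρ], (∀ᵐ y ∂ρ, |y| ≤ 1) → ∀ t : ℝ,
      charFun ρ t = ∑' n : ℕ, ((t : ℂ) * Complex.I) ^ n / (n.factorial : ℂ) * ((∫ y, y ^ n ∂ρ : ℝ) : ℂ) := by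
    intro ρ _ hρ t
    rw [charFun_apply_real]
    have hint : ∀ n : ℕ, Integrable (fun y : ℝ => ((t : ℂ) * Complex.I) ^ n / (n.factorial : ℂ) * ((y ^ n : ℝ) : ℂ)) ρ := by
      intro n
      have h0 : Integrable (fun y : ℝ => y ^ n) ρ := by
        apply Integrable.of_bound (C := 1) (by fun_prop)
        filter_upwards [hρ] with y hy
        rw [norm_pow, Real.norm_eq_abs]
        exact pow_le_one₀ (abs_nonneg _) hy
      exact h0.ofReal.const_mul _
    have hs := hasSum_integral_of_summable_integral_norm hint (by
      apply Summable.of_nonneg_of_le (f := fun n : ℕ => (ρ.real Set.univ) * (|t| ^ n / n.factorial))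
      · intro n; positivity
      · intro n
        calc _ ≤ ∫ y : ℝ, |t| ^ n / n.factorial ∂ρ := by
              apply integral_mono_ae (hint n).norm (integrable_const _)
              filter_upwards [hρ] with y hy
              simp only [norm_mul, norm_div, norm_pow, Complex.norm_real, Complex.norm_I, Real.norm_eq_abs, mul_one,
                Complex.norm_natCast]
              exact mul_le_of_le_one_right (by positivity) (by simpa [abs_pow] using pow_le_one₀ (abs_nonneg _) hy)
          _ = _ := by simp
      · exact (Real.summable_pow_div_factorial _).mul_left _)
    simp_rw [integral_const_mul, integral_complex_ofReal] at hs
    rw [hs.tsum_eq]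
    apply integral_congr_ae
    refine Filter.Eventually.of_forall fun y => ?_
    simp only
    rw [Complex.exp_eq_exp_ℂ, NormedSpace.exp_eq_tsum_div]
    refine tsum_congr fun n => ?_
    push_cast; ring
  apply Measure.ext_of_charFun
  ext t
  rw [key μ hμ, key ν hν]
  simp_rw [h]

/-- the shift kernel -/
def kern (B γ : ℝ) : ENNReal :=
  ENNReal.ofReal (if 0 < γ then Real.exp (-γ - B ^ 2 / (4 * γ) + B) / Real.sqrt (Real.pi * γ) else 0)

theorem kern_meas (B : ℝ) : Measurable (kern B) := by
  unfold kern
  apply Measurable.ennreal_ofReal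
  apply Measurable.ite measurableSet_Ioi (by fun_prop) (by fun_prop)

theorem kern_zero : ∫⁻ γ, kern 0 γ = 1 := by
  rw [← ProbabilityTheory.lintegral_gammaPDF_eq_one (a := 1/2) (r := 1) (by norm_num) (by norm_num)]
  apply lintegral_congr_ae
  have : ∀ᵐ x : ℝ, x ≠ 0 := by simp [ae_iff]
  filter_upwards [this] with x hx
  rw [ProbabilityTheory.gammaPDF_eq, kern]
  congr 1
  rcases lt_or_gt_of_ne hx with h | h
  · simp [not_lt.2 h.le, not_le.2 h]
  · simp only [h, h.le, if_true]
    rw [Real.Gamma_one_half_eq, Real.sqrt_mul Real.pi_pos.le, show (1/2 - 1 : ℝ) = -(1/2) by norm_num,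
      Real.rpow_neg h.le, ← Real.sqrt_eq_rpow x, Real.one_rpow]
    simp only [one_mul, ne_eq, OfNat.ofNat_ne_zero, not_false_eq_true, zero_pow, zero_div, sub_zero, add_zero]
    field_simp

theorem kern_pos (B : ℝ) (hB : 0 < B) : ∫⁻ γ, kern B γ = 1 := by
  have h1 : ∫⁻ γ, kern B γ = ∫⁻ γ in Set.Ioi 0, kern B γ := by
    rw [← lintegral_indicator measurableSet_Ioi]
    congr 1; ext γ
    by_cases h : 0 < γ
    · simp [h]
    · simp [h, kern]
  set F : ℝ → ENNReal := fun x => ENNReal.ofReal (2 / √Real.pi * Real.exp (-(x - B / (2 * x)) ^ 2)) with hF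
  have hFm : Measurable F := by fun_prop
  have h2 : ∫⁻ γ in Set.Ioi 0, kern B γ = ∫⁻ x in Set.Ioi 0, F x := by
    have := lintegral_image_eq_lintegral_abs_deriv_mul (s := Set.Ioi 0) (f := fun x : ℝ => x ^ 2) (f' := fun x => 2 * x)
      measurableSet_Ioi (fun x _ => by simpa using (hasDerivAt_pow 2 x).hasDerivWithinAt)
      (fun x hx y hy h => by
        have hx : 0 < x := hx
        have hy : 0 < y := hy
        simpa [pow_left_inj₀ hx.le hy.le] using h) (kern B)
    have him : (fun x : ℝ => x ^ 2) '' Set.Ioi 0 = Set.Ioi 0 := by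
      ext y; constructor
      · rintro ⟨x, hx, rfl⟩
        exact pow_pos (show 0 < x from hx) 2
      · intro hy
        exact ⟨√y, Real.sqrt_pos.2 hy, Real.sq_sqrt (le_of_lt hy)⟩
    rw [him] at this
    rw [this]
    apply setLIntegral_congr_fun measurableSet_Ioi
    intro x hx
    have hx : 0 < x := hx
    simp only [kern, hF]
    rw [if_pos (by positivity), ← ENNReal.ofReal_mul (by positivity), abs_of_pos (by positivity)]
    congr 1
    rw [Real.sqrt_mul Real.pi_pos.le, Real.sqrt_sq hx.le]
    rw [show -x ^ 2 - B ^ 2 / (4 * x ^ 2) + B = -(x - B / (2 * x)) ^ 2 by field_simp; ring]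
    field_simp
  have h3 : ∫⁻ x in Set.Ioi 0, F x = ∫⁻ x in Set.Ioi 0, ENNReal.ofReal (B / (2 * x ^ 2)) * F x := by
    have := lintegral_image_eq_lintegral_abs_deriv_mul (s := Set.Ioi 0) (f := fun x : ℝ => B / 2 * x⁻¹) (f' := fun x => B / 2 * (-(x^2)⁻¹))
      measurableSet_Ioi (fun x hx => ((hasDerivAt_inv (ne_of_gt hx)).const_mul _).hasDerivWithinAt)
      (fun x hx y hy h => by
        have : B / 2 ≠ 0 := by positivity
        simpa [hB.ne'] using h) F
    have him : (fun x : ℝ => B / 2 * x⁻¹) '' Set.Ioi 0 = Set.Ioi 0 := by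
      ext y; constructor
      · rintro ⟨x, hx, rfl⟩
        have hx : 0 < x := hx
        show 0 < B / 2 * x⁻¹
        positivity
      · intro hy
        have hy : 0 < y := hy
        refine ⟨B / 2 * y⁻¹, show 0 < B / 2 * y⁻¹ by positivity, ?_⟩
        field_simp
    rw [him] at this
    rw [this]
    apply setLIntegral_congr_fun measurableSet_Ioi
    intro x hx
    have hx : 0 < x := hx
    simp only [hF]
    congr 2
    · rw [mul_neg, abs_neg, abs_of_pos (by positivity)]; field_simp
    · congr 2
      field_simp
      ring
  have h4 : ∫⁻ x in Set.Ioi 0, F x + ENNReal.ofReal (B / (2 * x ^ 2)) * F x = 2 := by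
    have hd : ∀ x ∈ Set.Ioi (0:ℝ), HasDerivWithinAt (fun x : ℝ => x - B / 2 * x⁻¹) (1 - B / 2 * (-(x^2)⁻¹)) (Set.Ioi 0) x :=
      fun x hx => ((hasDerivAt_id x).sub ((hasDerivAt_inv (ne_of_gt hx)).const_mul _)).hasDerivWithinAt
    have := lintegral_image_eq_lintegral_abs_deriv_mul (s := Set.Ioi 0) 
      measurableSet_Ioi hd
      (fun x hx y hy h => by
        have hx : 0 < x := hx
        have hy : 0 < y := hy
        simp only at h
        by_contra hne
        have e : (x - y) * (1 + B / 2 * (x⁻¹ * y⁻¹)) = 0 := by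
          have : (x - y) * (1 + B / 2 * (x⁻¹ * y⁻¹)) = (x - B / 2 * x⁻¹) - (y - B / 2 * y⁻¹) := by
            field_simp; ring
          rw [this, h, sub_self]
        rcases mul_eq_zero.1 e with e | e
        · exact hne (sub_eq_zero.1 e)
        · have : 0 < 1 + B / 2 * (x⁻¹ * y⁻¹) := by positivity
          linarith) (fun u => ENNReal.ofReal (2 / √Real.pi * Real.exp (-u ^ 2)))
    have him : (fun x : ℝ => x - B / 2 * x⁻¹) '' Set.Ioi 0 = Set.univ := by
      apply Set.eq_univ_of_forall
      intro y
      have hs : |y| < √(y ^ 2 + 2 * B) := by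
        rw [← Real.sqrt_sq_eq_abs]
        exact Real.sqrt_lt_sqrt (sq_nonneg _) (by linarith)
      have hs2 := Real.sq_sqrt (show 0 ≤ y ^ 2 + 2 * B by positivity)
      have hp : 0 < (y + √(y ^ 2 + 2 * B)) / 2 := by have := neg_abs_le y; linarith
      refine ⟨(y + √(y ^ 2 + 2 * B)) / 2, hp, ?_⟩
      have hp' : y + √(y ^ 2 + 2 * B) ≠ 0 := by linarith
      simp only
      field_simp
      nlinarith
    rw [him, setLIntegral_univ] at this
    have hg : ∫⁻ u : ℝ, ENNReal.ofReal (2 / √Real.pi * Real.exp (-u ^ 2)) = 2 := by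
      rw [← ofReal_integral_eq_lintegral_ofReal]
      · have := integral_gaussian 1
        simp only [neg_mul, one_mul, div_one] at this
        rw [integral_const_mul, this, div_mul_cancel₀ _ (by positivity)]
        simp
      · have := integrable_exp_neg_mul_sq (b := 1) one_pos
        simp only [neg_mul, one_mul] at this
        exact this.const_mul _
      · exact Filter.Eventually.of_forall fun x => by positivity
    rw [hg] at this
    rw [this]
    apply setLIntegral_congr_fun measurableSet_Ioi
    intro x hx
    have hx : 0 < x := hx
    simp only [hF]
    rw [← ENNReal.ofReal_mul (by positivity), ← ENNReal.ofReal_add (by positivity) (by positivity),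
      ← ENNReal.ofReal_mul (by positivity)]
    congr 1
    rw [mul_neg, sub_neg_eq_add, abs_of_pos (by positivity)]
    rw [show x - B / (2 * x) = x - B / 2 * x⁻¹ by field_simp]
    field_simp
  rw [lintegral_add_left hFm, ← h3, ← h2, ← h1, ← two_mul] at h4
  have : (2 : ENNReal) * ∫⁻ γ, kern B γ = 2 * 1 := by rw [h4, mul_one]
  exact (ENNReal.mul_right_inj (by simp) (by simp)).1 this

theorem kern_int (B : ℝ) (hB : 0 ≤ B) : ∫⁻ γ, kern B γ = 1 := by
  rcases hB.eq_or_lt with rfl | h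
  · exact kern_zero
  · exact kern_pos B h
theorem ext_laplace {α α' : Type*} [MeasurableSpace α] [MeasurableSpace α'] (μ : Measure α) (ν : Measure α')
    (X : α → ℝ) (X' : α' → ℝ) (hX : Measurable X) (hX' : Measurable X')
    (h0 : ∀ᵐ a ∂μ, 0 ≤ X a) (h0' : ∀ᵐ a ∂ν, 0 ≤ X' a) [IsFiniteMeasure μ] [IsFiniteMeasure ν]
    (h : ∀ n : ℕ, ∫⁻ a, ENNReal.ofReal (Real.exp (-(n * X a))) ∂μ = ∫⁻ a, ENNReal.ofReal (Real.exp (-(n * X' a))) ∂ν) :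
    Measure.map X μ = Measure.map X' ν := by
  have key : Measure.map (fun a => Real.exp (-X a)) μ = Measure.map (fun a => Real.exp (-X' a)) ν := by
    have hm : Measurable (fun a => Real.exp (-X a)) := by fun_prop
    have hm' : Measurable (fun a => Real.exp (-X' a)) := by fun_prop
    have hs : MeasurableSet {y : ℝ | |y| ≤ 1} := measurableSet_le (by fun_prop) (by fun_prop)
    apply ext_moments
    · rw [ae_map_iff hm.aemeasurable hs]
      filter_upwards [h0] with a ha
      rw [abs_of_pos (Real.exp_pos _)]
      simpa using ha
    · rw [ae_map_iff hm'.aemeasurable hs]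
      filter_upwards [h0'] with a ha
      rw [abs_of_pos (Real.exp_pos _)]
      simpa using ha
    · intro n
      have e : ∀ x : ℝ, Real.exp (-x) ^ n = Real.exp (-(n * x)) := by
        intro x; rw [← Real.exp_nat_mul]; ring_nf
      rw [integral_map hm.aemeasurable (by fun_prop), integral_map hm'.aemeasurable (by fun_prop)]
      simp_rw [e]
      rw [integral_eq_lintegral_of_nonneg_ae (Filter.Eventually.of_forall fun _ => (Real.exp_pos _).le) (by fun_prop),
        integral_eq_lintegral_of_nonneg_ae (Filter.Eventually.of_forall fun _ => (Real.exp_pos _).le) (by fun_prop), h]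
  have h2 := congrArg (Measure.map (fun y => -Real.log y)) key
  rw [Measure.map_map (by fun_prop) (by fun_prop), Measure.map_map (by fun_prop) (by fun_prop)] at h2
  simpa [Function.comp_def] using h2

theorem mmatrix_nonneg {U : Type*} [Fintype U] [DecidableEq U] (M : Matrix U U ℝ) (hM : M.PosDef)
    (hoff : ∀ i j, i ≠ j → M i j ≤ 0) (y : U → ℝ) (hy : ∀ i, 0 ≤ y i) (i : U) : 0 ≤ (M⁻¹ *ᵥ y) i := by
  set x := M⁻¹ *ᵥ y with hx
  have hxy : M *ᵥ x = y := by
    rw [hx, mulVec_mulVec, mul_nonsing_inv _ ((Matrix.isUnit_iff_isUnit_det _).1 hM.isUnit), one_mulVec]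
  set m : U → ℝ := fun i => max (-x i) 0 with hm
  have h1 : m ⬝ᵥ (M *ᵥ (x + m)) ≤ 0 := by
    simp only [dotProduct, mulVec, Finset.mul_sum]
    apply Finset.sum_nonpos; intro i _
    apply Finset.sum_nonpos; intro j _
    have hmi : 0 ≤ m i := le_max_right _ _
    have hxj : 0 ≤ (x + m) j := by
      have := le_max_left (-x j) 0
      simp only [Pi.add_apply, hm]; linarith
    by_cases hij : i = j
    · subst hij
      have : m i * (x + m) i = 0 := by
        simp only [Pi.add_apply, hm]
        rcases le_total (-x i) 0 with h | h
        · rw [max_eq_right h]; simp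
        · rw [max_eq_left h]; simp
      rw [mul_left_comm, this, mul_zero]
    · exact mul_nonpos_of_nonneg_of_nonpos hmi (mul_nonpos_of_nonpos_of_nonneg (hoff i j hij) hxj)
  rw [mulVec_add, dotProduct_add, hxy] at h1
  have h2 : 0 ≤ m ⬝ᵥ y := by
    apply Finset.sum_nonneg; intro i _
    exact mul_nonneg (le_max_right _ _) (hy i)
  have h3 : m = 0 := by
    by_contra hne
    have := hM.dotProduct_mulVec_pos hne
    simp only [star_trivial] at this
    linarith
  have h4 : m i = 0 := by rw [h3]; rfl
  have := le_max_left (-x i) 0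
  simp only [hm] at h4
  linarith

theorem Hmat_apply {V : Type*} [Fintype V] [DecidableEq V] (W : Matrix V V ℝ) (β : V → ℝ) (i j : V) :
    Hmat W β i j = (if i = j then 2 * β i else 0) - W i j := by
  unfold Hmat
  rw [Matrix.sub_apply, Matrix.smul_apply, diagonal_apply]
  split_ifs <;> simp

theorem Hmat_cont {V : Type*} [Fintype V] [DecidableEq V] (W : Matrix V V ℝ) : Continuous (Hmat W) := by
  unfold Hmat; fun_prop

theorem meas_quad {V : Type*} [Fintype V] [DecidableEq V] (W : Matrix V V ℝ) (η : V → ℝ) :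
    Measurable (fun β : V → ℝ => η ⬝ᵥ (Hmat W β)⁻¹.mulVec η) := by
  have hc := Hmat_cont W
  have h : (fun β : V → ℝ => η ⬝ᵥ (Hmat W β)⁻¹.mulVec η)
      = fun β => (Hmat W β).det⁻¹ * (η ⬝ᵥ (Hmat W β).adjugate.mulVec η) := by
    ext β
    rw [Matrix.inv_def, smul_mulVec, dotProduct_smul, Ring.inverse_eq_inv', smul_eq_mul]
  rw [h]
  apply Measurable.mul
  · exact (hc.matrix_det.measurable).inv
  · apply Continuous.measurable
    exact Continuous.dotProduct continuous_const (Continuous.matrix_mulVec hc.matrix_adjugate continuous_const)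

theorem Hmat_herm {V : Type*} [Fintype V] [DecidableEq V] (W : Matrix V V ℝ) (hW : W.IsSymm) (β : V → ℝ) :
    (Hmat W β).IsHermitian := by
  rw [IsHermitian, conjTranspose_eq_transpose_of_trivial]
  ext i j
  rw [transpose_apply, Hmat_apply, Hmat_apply, hW.apply i j]
  by_cases h : i = j
  · subst h; rfl
  · rw [if_neg h, if_neg (Ne.symm h)]

theorem meas_pd {V : Type*} [Fintype V] [DecidableEq V] (W : Matrix V V ℝ) (hW : W.IsSymm) :
    MeasurableSet {β : V → ℝ | (Hmat W β).PosDef} := by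
  have hc := Hmat_cont W
  have h : {β : V → ℝ | (Hmat W β).PosDef} =
      {β : V → ℝ | ∀ x : V → ℝ, 0 ≤ x ⬝ᵥ (Hmat W β *ᵥ x)} ∩ {β | (Hmat W β).det ≠ 0} := by
    ext β
    constructor
    · intro h
      exact ⟨fun x => by simpa using h.posSemidef.dotProduct_mulVec_nonneg x, h.det_pos.ne'⟩
    · rintro ⟨h1, h2⟩
      exact ((PosSemidef.of_dotProduct_mulVec_nonneg (Hmat_herm W hW β)
        (fun x => by simpa using h1 x)).posDef_iff_det_ne_zero).2 h2
  rw [h]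
  apply MeasurableSet.inter
  · apply IsClosed.measurableSet
    simp only [Set.ofPred_forall]
    apply isClosed_iInter; intro x
    exact isClosed_le continuous_const
      (Continuous.dotProduct continuous_const (Continuous.matrix_mulVec hc continuous_const))
  · exact (hc.matrix_det.measurable) (measurableSet_singleton 0).compl

theorem nuDens_meas {V : Type*} [Fintype V] [DecidableEq V] (W : Matrix V V ℝ) (hW : W.IsSymm) (η : V → ℝ) :
    Measurable (nuDens W η) := by
  have hc := Hmat_cont W
  unfold nuDens
  refine Measurable.indicator ?_ (meas_pd W hW)
  have h1 : Measurable fun β => (1 : V → ℝ) ⬝ᵥ (Hmat W β).mulVec 1 :=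
    (Continuous.dotProduct continuous_const (Continuous.matrix_mulVec hc continuous_const)).measurable
  have h2 := meas_quad W η
  have h3 : Measurable fun β => (Hmat W β).det := hc.matrix_det.measurable
  fun_prop

theorem nuDens_equiv {V V' : Type*} [Fintype V] [DecidableEq V] [Fintype V'] [DecidableEq V'] (e : V ≃ V')
    (W : Matrix V' V' ℝ) (η : V' → ℝ) (β : V' → ℝ) :
    nuDens W η β = nuDens (W.submatrix e e) (η ∘ e) (β ∘ e) := by
  have hH : Hmat (W.submatrix e e) (β ∘ e) = (Hmat W β).submatrix e e := by
    ext i j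
    simp [Hmat_apply]
  have hpd : ((Hmat W β).submatrix e e).PosDef ↔ (Hmat W β).PosDef := by
    constructor
    · intro h
      have := h.submatrix e.symm.injective
      simpa using this
    · intro h; exact h.submatrix e.injective
  have e1 : (1 : V → ℝ) ⬝ᵥ (Hmat W β).submatrix e e *ᵥ 1 = (1 : V' → ℝ) ⬝ᵥ Hmat W β *ᵥ 1 := by
    rw [submatrix_mulVec_equiv]
    exact comp_equiv_dotProduct_comp_equiv (1 : V' → ℝ) _ e
  have e2 : (η ∘ e) ⬝ᵥ ((Hmat W β).submatrix e e)⁻¹ *ᵥ (η ∘ e) = η ⬝ᵥ (Hmat W β)⁻¹ *ᵥ η := by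
    rw [inv_submatrix_equiv, submatrix_mulVec_equiv, Function.comp_assoc, e.self_comp_symm, Function.comp_id]
    exact comp_equiv_dotProduct_comp_equiv η _ e
  have e3 : (η ∘ e) ⬝ᵥ (1 : V → ℝ) = η ⬝ᵥ (1 : V' → ℝ) :=
    comp_equiv_dotProduct_comp_equiv η (1 : V' → ℝ) e
  unfold nuDens
  by_cases hp : (Hmat W β).PosDef
  · rw [Set.indicator_of_mem (show β ∈ {β : V' → ℝ | (Hmat W β).PosDef} from hp),
      Set.indicator_of_mem (show β ∘ e ∈ {β : V → ℝ | (Hmat (W.submatrix e e) β).PosDef} from by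
        show (Hmat _ _).PosDef
        rw [hH]; exact hpd.2 hp)]
    rw [hH, e1, e2, e3, det_submatrix_equiv_self, Fintype.card_congr e]
  · rw [Set.indicator_of_notMem (show β ∉ {β : V' → ℝ | (Hmat W β).PosDef} from hp),
      Set.indicator_of_notMem (show β ∘ e ∉ {β : V → ℝ | (Hmat (W.submatrix e e) β).PosDef} from by
        show ¬ (Hmat _ _).PosDef
        rw [hH, hpd]; exact hp)]

theorem nuDens_of_pd {V : Type*} [Fintype V] [DecidableEq V] {W : Matrix V V ℝ} {β : V → ℝ}
    (h : (Hmat W β).PosDef) (η : V → ℝ) : nuDens W η β = ENNReal.ofReal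
      ((2 / Real.pi) ^ ((Fintype.card V : ℝ) / 2) *
        Real.exp (-(1 / 2) * ((1 : V → ℝ) ⬝ᵥ (Hmat W β).mulVec 1
            + η ⬝ᵥ (Hmat W β)⁻¹.mulVec η) + η ⬝ᵥ (1 : V → ℝ)) /
        Real.sqrt (Hmat W β).det) :=
  Set.indicator_of_mem (s := {β : V → ℝ | (Hmat W β).PosDef}) h _

theorem nuDens_of_not_pd {V : Type*} [Fintype V] [DecidableEq V] {W : Matrix V V ℝ} {β : V → ℝ}
    (h : ¬ (Hmat W β).PosDef) (η : V → ℝ) : nuDens W η β = 0 :=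
  Set.indicator_of_notMem (s := {β : V → ℝ | (Hmat W β).PosDef}) h _

section block
variable {U : Type*} [Fintype U] [DecidableEq U] (W : Matrix (Unit ⊕ U) (Unit ⊕ U) ℝ)

theorem block_H (hW : W.IsSymm) (b : ℝ) (βU : U → ℝ) :
    Hmat W (Sum.elim (fun _ => b) βU) =
      fromBlocks (of fun _ _ : Unit => 2 * b - W (.inl ()) (.inl ())) (of fun _ u => - W (.inl ()) (.inr u))
        (of fun _ u => - W (.inl ()) (.inr u))ᴴ (Hmat W.toBlocks₂₂ βU) := by
  ext i j
  rcases i with i | i <;> rcases j with j | j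
  · simp [Hmat_apply]
  · simp [Hmat_apply]
  · simp [Hmat_apply, hW.apply]
  · simp [Hmat_apply, toBlocks₂₂]

theorem block_schur (a : ℝ) (w : U → ℝ) (G : Matrix U U ℝ) :
    ((of fun _ _ => a : Matrix Unit Unit ℝ) - (of fun _ u => - w u : Matrix Unit U ℝ) * G * (of fun _ u => - w u : Matrix Unit U ℝ)ᴴ)
      = diagonal (fun _ => a - w ⬝ᵥ G *ᵥ w) := by
  ext i j
  rw [Subsingleton.elim j i, diagonal_apply_eq, Matrix.sub_apply]
  congr 1
  rw [Matrix.mul_assoc]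
  simp [Matrix.mul_apply, dotProduct, mulVec]

theorem block_pd (hW : W.IsSymm) (b : ℝ) (βU : U → ℝ) (hD : (Hmat W.toBlocks₂₂ βU).PosDef) :
    (Hmat W (Sum.elim (fun _ => b) βU)).det = (Hmat W.toBlocks₂₂ βU).det *
      (2 * b - W (.inl ()) (.inl ()) - (fun u => W (.inl ()) (.inr u)) ⬝ᵥ (Hmat W.toBlocks₂₂ βU)⁻¹ *ᵥ (fun u => W (.inl ()) (.inr u))) ∧
    ((Hmat W (Sum.elim (fun _ => b) βU)).PosDef ↔
      0 < (2 * b - W (.inl ()) (.inl ()) - (fun u => W (.inl ()) (.inr u)) ⬝ᵥ (Hmat W.toBlocks₂₂ βU)⁻¹ *ᵥ (fun u => W (.inl ()) (.inr u)))) := by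
  have : Invertible (Hmat W.toBlocks₂₂ βU) := hD.isUnit.invertible
  set s := (2 * b - W (.inl ()) (.inl ()) - (fun u => W (.inl ()) (.inr u)) ⬝ᵥ (Hmat W.toBlocks₂₂ βU)⁻¹ *ᵥ (fun u => W (.inl ()) (.inr u))) with hs
  have hdet : (Hmat W (Sum.elim (fun _ => b) βU)).det = (Hmat W.toBlocks₂₂ βU).det * s := by
    rw [block_H W hW, det_fromBlocks₂₂, invOf_eq_nonsing_inv,
      block_schur (2 * b - W (.inl ()) (.inl ())) (fun u => W (.inl ()) (.inr u))]
    simp [hs]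
  have hpsd : (Hmat W (Sum.elim (fun _ => b) βU)).PosSemidef ↔ 0 ≤ s := by
    rw [block_H W hW, Matrix.PosDef.fromBlocks₂₂ _ _ hD,
      block_schur (2 * b - W (.inl ()) (.inl ())) (fun u => W (.inl ()) (.inr u)), posSemidef_diagonal_iff]
    simp [hs]
  refine ⟨hdet, fun h => ?_, fun h => ?_⟩
  · have := h.det_pos
    rw [hdet] at this
    exact (mul_pos_iff_of_pos_left hD.det_pos).1 this
  · rw [(hpsd.2 h.le).posDef_iff_det_ne_zero, hdet]
    exact (mul_pos hD.det_pos h).ne'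

theorem block_sub_pd (b : ℝ) (βU : U → ℝ) (h : (Hmat W (Sum.elim (fun _ => b) βU)).PosDef) :
    (Hmat W.toBlocks₂₂ βU).PosDef := by
  have := h.submatrix (e := Sum.inr) Sum.inr_injective
  convert this using 1
  ext i j
  simp [Hmat_apply, toBlocks₂₂]

theorem block_one (hW : W.IsSymm) (b : ℝ) (βU : U → ℝ) :
    (1 : Unit ⊕ U → ℝ) ⬝ᵥ (Hmat W (Sum.elim (fun _ => b) βU)) *ᵥ 1
      = (2 * b - W (.inl ()) (.inl ())) - 2 * ((fun u => W (.inl ()) (.inr u)) ⬝ᵥ (1 : U → ℝ))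
        + (1 : U → ℝ) ⬝ᵥ (Hmat W.toBlocks₂₂ βU) *ᵥ 1 := by
  rw [block_H W hW]
  simp [dotProduct, mulVec, Fintype.sum_sum_type, Finset.sum_add_distrib]
  ring

theorem block_quad (hW : W.IsSymm) (b : ℝ) (βU : U → ℝ) (hD : (Hmat W.toBlocks₂₂ βU).PosDef) (η : Unit ⊕ U → ℝ)
    (w ηU : U → ℝ) (hw : w = fun u => W (.inl ()) (.inr u)) (hηU : ηU = fun u => η (.inr u))
    (s : ℝ) (hs : s = 2 * b - W (.inl ()) (.inl ()) - w ⬝ᵥ (Hmat W.toBlocks₂₂ βU)⁻¹ *ᵥ w) (hpos : 0 < s) :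
    η ⬝ᵥ (Hmat W (Sum.elim (fun _ => b) βU))⁻¹ *ᵥ η
      = ηU ⬝ᵥ (Hmat W.toBlocks₂₂ βU)⁻¹ *ᵥ ηU + (η (.inl ()) + w ⬝ᵥ (Hmat W.toBlocks₂₂ βU)⁻¹ *ᵥ ηU) ^ 2 / s := by
  have hH : (Hmat W (Sum.elim (fun _ => b) βU)).PosDef := by
    rw [(block_pd W hW b βU hD).2]; rw [hs, hw] at hpos; exact hpos
  set D := Hmat W.toBlocks₂₂ βU with hDdef
  have hsym : ηU ⬝ᵥ D⁻¹ *ᵥ w = w ⬝ᵥ D⁻¹ *ᵥ ηU := by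
    have hT : (D⁻¹)ᵀ = D⁻¹ := by
      have := hD.isHermitian.inv
      rwa [IsHermitian, conjTranspose_eq_transpose_of_trivial] at this
    rw [dotProduct_mulVec, ← mulVec_transpose, hT, dotProduct_comm]
  have hDD : ∀ v, D *ᵥ (D⁻¹ *ᵥ v) = v := fun v => by
    rw [mulVec_mulVec, mul_nonsing_inv _ ((Matrix.isUnit_iff_isUnit_det _).1 hD.isUnit), one_mulVec]
  set B := η (.inl ()) + w ⬝ᵥ D⁻¹ *ᵥ ηU with hB
  set x : Unit ⊕ U → ℝ := Sum.elim (fun _ => B / s) (D⁻¹ *ᵥ ηU + (B / s) • (D⁻¹ *ᵥ w)) with hx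
  have hHx : Hmat W (Sum.elim (fun _ => b) βU) *ᵥ x = η := by
    rw [block_H W hW, hx, fromBlocks_mulVec]
    have a1 : (of fun (_ : Unit) u => - W (.inl ()) (.inr u) : Matrix Unit U ℝ) = of fun _ u => - w u := by rw [hw]
    rw [a1, Sum.elim_comp_inl, Sum.elim_comp_inr, ← hDdef]
    ext i
    rcases i with i | u
    · have : ((of fun (_ : Unit) u => - w u : Matrix Unit U ℝ) *ᵥ (D⁻¹ *ᵥ ηU + (B / s) • (D⁻¹ *ᵥ w))) i
          = - (w ⬝ᵥ D⁻¹ *ᵥ ηU) - (B / s) * (w ⬝ᵥ D⁻¹ *ᵥ w) := by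
        rw [show ((of fun (_ : Unit) u => - w u : Matrix Unit U ℝ) *ᵥ (D⁻¹ *ᵥ ηU + (B / s) • (D⁻¹ *ᵥ w))) i
          = (-w) ⬝ᵥ (D⁻¹ *ᵥ ηU + (B / s) • (D⁻¹ *ᵥ w)) from rfl]
        rw [dotProduct_add, dotProduct_smul, neg_dotProduct, neg_dotProduct, smul_eq_mul]
        ring
      simp only [Sum.elim_inl, Pi.add_apply]
      rw [this]
      simp only [mulVec, dotProduct, of_apply, Finset.univ_unique, Finset.sum_singleton]
      simp only [mulVec, dotProduct] at hs hB
      have e1 : 2 * b - W (.inl ()) (.inl ()) = s + ∑ u, w u * ∑ v, D⁻¹ u v * w v := by rw [hs]; ring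
      rw [e1]
      have e2 : (∑ u, w u * ∑ v, D⁻¹ u v * ηU v) = B - η (.inl ()) := by rw [hB]; ring
      rw [e2]
      field_simp
      ring
    · simp only [Sum.elim_inr, Pi.add_apply, mulVec_add, mulVec_smul, hDD]
      simp [mulVec, dotProduct, hηU]
      ring
  have hinv : (Hmat W (Sum.elim (fun _ => b) βU))⁻¹ *ᵥ η = x := by
    rw [← hHx, mulVec_mulVec, nonsing_inv_mul _ ((Matrix.isUnit_iff_isUnit_det _).1 hH.isUnit), one_mulVec]
  rw [hinv]
  have : η ⬝ᵥ x = η (.inl ()) * (B / s) + ηU ⬝ᵥ (D⁻¹ *ᵥ ηU + (B / s) • (D⁻¹ *ᵥ w)) := by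
    rw [dotProduct, Fintype.sum_sum_type]
    simp [hx, dotProduct, show ∀ u, η (.inr u) = ηU u from fun u => by rw [hηU]]
  rw [this, dotProduct_add, dotProduct_smul, hsym, smul_eq_mul]
  have e2 : w ⬝ᵥ D⁻¹ *ᵥ ηU = B - η (.inl ()) := by rw [hB]; ring
  rw [e2]
  field_simp
  ring

theorem block_dens (hW : W.IsSymm) (b : ℝ) (βU : U → ℝ) (hD : (Hmat W.toBlocks₂₂ βU).PosDef) (η : Unit ⊕ U → ℝ)
    (w ηU : U → ℝ) (hw : w = fun u => W (.inl ()) (.inr u)) (hηU : ηU = fun u => η (.inr u)) :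
    nuDens W η (Sum.elim (fun _ => b) βU) = nuDens W.toBlocks₂₂ (ηU + w) βU *
      kern (η (.inl ()) + w ⬝ᵥ (Hmat W.toBlocks₂₂ βU)⁻¹ *ᵥ ηU)
        (b - (W (.inl ()) (.inl ()) + w ⬝ᵥ (Hmat W.toBlocks₂₂ βU)⁻¹ *ᵥ w) / 2) := by
  obtain ⟨hdet, hpd⟩ := block_pd W hW b βU hD
  rw [← hw] at hdet hpd
  set γ := (b - (W (.inl ()) (.inl ()) + w ⬝ᵥ (Hmat W.toBlocks₂₂ βU)⁻¹ *ᵥ w) / 2) with hγ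
  have hs : 2 * b - W (.inl ()) (.inl ()) - w ⬝ᵥ (Hmat W.toBlocks₂₂ βU)⁻¹ *ᵥ w = 2 * γ := by rw [hγ]; ring
  rw [hs] at hdet hpd
  by_cases hp : 0 < γ
  · have hH := hpd.2 (by linarith)
    have hq := block_quad W hW b βU hD η w ηU hw hηU (2 * γ) hs.symm (by linarith)
    have h1 := block_one W hW b βU
    rw [← hw] at h1
    rw [nuDens_of_pd hH, nuDens_of_pd hD, hq, h1, hdet, kern, if_pos hp, ← ENNReal.ofReal_mul (by positivity)]
    have hdp := hD.det_pos
    have hsym : ηU ⬝ᵥ (Hmat W.toBlocks₂₂ βU)⁻¹ *ᵥ w = w ⬝ᵥ (Hmat W.toBlocks₂₂ βU)⁻¹ *ᵥ ηU := by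
      have hT : ((Hmat W.toBlocks₂₂ βU)⁻¹)ᵀ = (Hmat W.toBlocks₂₂ βU)⁻¹ := by
        have := hD.isHermitian.inv
        rwa [IsHermitian, conjTranspose_eq_transpose_of_trivial] at this
      rw [dotProduct_mulVec, ← mulVec_transpose, hT, dotProduct_comm]
    have hη1 : η ⬝ᵥ (1 : Unit ⊕ U → ℝ) = η (.inl ()) + ηU ⬝ᵥ (1 : U → ℝ) := by
      simp [dotProduct, Fintype.sum_sum_type, hηU]
    rw [mulVec_add, dotProduct_add, add_dotProduct, add_dotProduct, add_dotProduct, hsym, hη1]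
    generalize (Hmat W.toBlocks₂₂ βU).det = d at *
    generalize ηU ⬝ᵥ (Hmat W.toBlocks₂₂ βU)⁻¹ *ᵥ ηU = q1 at *
    generalize w ⬝ᵥ (Hmat W.toBlocks₂₂ βU)⁻¹ *ᵥ ηU = q2 at *
    generalize w ⬝ᵥ (Hmat W.toBlocks₂₂ βU)⁻¹ *ᵥ w = q3 at *
    generalize w ⬝ᵥ (1 : U → ℝ) = q4 at *
    generalize ηU ⬝ᵥ (1 : U → ℝ) = q5 at *
    generalize (1 : U → ℝ) ⬝ᵥ Hmat W.toBlocks₂₂ βU *ᵥ 1 = q6 at *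
    generalize η (.inl ()) = q7 at *
    generalize W (.inl ()) (.inl ()) = q8 at *
    clear_value γ
    have hb : b = γ + (q8 + q3) / 2 := by linarith
    subst hb
    congr 1
    have hexp : -(1 / 2) * (2 * (γ + (q8 + q3) / 2) - q8 - 2 * q4 + q6 + (q1 + (q7 + q2) ^ 2 / (2 * γ))) + (q7 + q5)
        = (-(1 / 2) * (q6 + (q1 + q2 + (q2 + q3))) + (q5 + q4)) + (-γ - (q7 + q2) ^ 2 / (4 * γ) + (q7 + q2)) := by
      field_simp
      ring
    rw [hexp, Real.exp_add]
    have hcard : ((Fintype.card (Unit ⊕ U) : ℕ) : ℝ) / 2 = 1 / 2 + (Fintype.card U : ℝ) / 2 := by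
      simp; ring
    rw [hcard, Real.rpow_add (by positivity), ← Real.sqrt_eq_rpow, Real.sqrt_mul hdp.le, Real.sqrt_mul (by norm_num),
      Real.sqrt_mul Real.pi_pos.le, Real.sqrt_div (by norm_num)]
    have hd0 : √d ≠ 0 := (Real.sqrt_pos.2 hdp).ne'
    field_simp
  · have hH : ¬ (Hmat W (Sum.elim (fun _ => b) βU)).PosDef := fun h => hp (by have := hpd.1 h; linarith)
    rw [nuDens_of_not_pd hH, kern, if_neg hp]
    simp

end block

/-- The normalisation statement for one index type. -/
def NormOne (V : Type*) [Fintype V] [DecidableEq V] : Prop :=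
  ∀ W : Matrix V V ℝ, W.IsSymm → (∀ i j, 0 ≤ W i j) → ∀ η : V → ℝ, (∀ i, 0 ≤ η i) →
    ∫⁻ β, nuDens W η β = 1

theorem normOne_equiv {V V' : Type*} [Fintype V] [DecidableEq V] [Fintype V'] [DecidableEq V'] (e : V ≃ V')
    (h : NormOne V) : NormOne V' := by
  intro W hW hnn η hη
  rw [← h (W.submatrix e e) (hW.submatrix e) (fun i j => hnn _ _) (η ∘ e) (fun i => hη _)]
  have hmp := volume_measurePreserving_piCongrLeft (fun _ : V => ℝ) e.symm
  rw [← hmp.lintegral_comp_emb (MeasurableEquiv.measurableEmbedding _)]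
  apply lintegral_congr
  intro β
  rw [nuDens_equiv e]
  congr 1
  ext i
  have := MeasurableEquiv.piCongrLeft_apply_apply (β := fun _ : V => ℝ) e.symm β (e i)
  simp at this
  simp [this]

theorem normOne_empty (V : Type*) [Fintype V] [DecidableEq V] [IsEmpty V] : NormOne V := by
  intro W hW hnn η hη
  have : ∀ β : V → ℝ, nuDens W η β = 1 := by
    intro β
    have hpd : (Hmat W β).PosDef := by
      refine PosDef.of_dotProduct_mulVec_pos (Hmat_herm W hW β) fun x hx => ?_
      exact absurd (Subsingleton.elim _ _) hx
    rw [nuDens_of_pd hpd]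
    simp
  simp only [this, lintegral_one]
  rw [volume_pi, Measure.pi_of_empty (x := isEmptyElim)]
  simp

theorem normOne_succ {U : Type*} [Fintype U] [DecidableEq U] (h : NormOne U) : NormOne (Unit ⊕ U) := by
  intro W hW hnn η hη
  set w : U → ℝ := fun u => W (.inl ()) (.inr u) with hw
  set ηU : U → ℝ := fun u => η (.inr u) with hηU
  have hWU : W.toBlocks₂₂.IsSymm := by
    ext i j
    exact hW.apply _ _
  rw [← h W.toBlocks₂₂ hWU (fun i j => hnn _ _) (ηU + w) (fun i => add_nonneg (hη _) (hnn _ _))]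
  have hmp := (volume_measurePreserving_sumPiEquivProdPi_symm (fun _ : Unit ⊕ U => ℝ))
  rw [← hmp.lintegral_comp_emb (MeasurableEquiv.measurableEmbedding _)]
  have hm := nuDens_meas W hW η
  rw [show (volume : Measure ((Unit → ℝ) × (U → ℝ))) = volume.prod volume from rfl]
  rw [lintegral_prod_symm (fun z : (Unit → ℝ) × (U → ℝ) =>
    nuDens W η ((MeasurableEquiv.sumPiEquivProdPi (fun _ : Unit ⊕ U => ℝ)).symm z))
    (hm.comp (MeasurableEquiv.measurable _)).aemeasurable]
  apply lintegral_congr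
  intro βU
  have hmu := (volume_preserving_funUnique Unit ℝ).symm
  rw [← hmu.lintegral_comp_emb (MeasurableEquiv.measurableEmbedding _)]
  have he : ∀ b : ℝ, (MeasurableEquiv.sumPiEquivProdPi (fun _ : Unit ⊕ U => ℝ)).symm
      ((MeasurableEquiv.funUnique Unit ℝ).symm b, βU) = Sum.elim (fun _ => b) βU := by
    intro b
    ext i
    rcases i with i | i <;> rfl
  simp_rw [he]
  by_cases hD : (Hmat W.toBlocks₂₂ βU).PosDef
  · simp_rw [fun b => block_dens W hW b βU hD η w ηU hw hηU]
    have hB : 0 ≤ η (.inl ()) + w ⬝ᵥ (Hmat W.toBlocks₂₂ βU)⁻¹ *ᵥ ηU := by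
      apply add_nonneg (hη _)
      apply Finset.sum_nonneg
      intro i _
      apply mul_nonneg (hnn _ _)
      apply mmatrix_nonneg _ hD _ _ (fun i => hη _)
      intro i j hij
      rw [Hmat_apply, if_neg hij]
      have : 0 ≤ W.toBlocks₂₂ i j := hnn _ _
      linarith
    rw [lintegral_const_mul' _ _ (by rw [nuDens_of_pd hD]; exact ENNReal.ofReal_ne_top),
      lintegral_sub_right_eq_self (fun γ => kern _ γ), kern_int _ hB, mul_one]
  · rw [nuDens_of_not_pd hD]
    simp_rw [fun b => nuDens_of_not_pd (fun h => hD (block_sub_pd W b βU h)) η]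
    simp

theorem normOne_fin (n : ℕ) : NormOne (Fin n) := by
  induction n with
  | zero => exact normOne_empty _
  | succ n ih =>
    exact normOne_equiv (((Equiv.sumComm _ _).trans ((Equiv.refl _).sumCongr finOneEquiv.symm)).trans finSumFinEquiv)
      (normOne_succ ih)

theorem normOne_all (V : Type*) [Fintype V] [DecidableEq V] : NormOne V :=
  normOne_equiv (Fintype.equivFin V).symm (normOne_fin _)

theorem nuDens_smul {V : Type*} [Fintype V] [DecidableEq V] (W : Matrix V V ℝ) (η : V → ℝ) (t : ℝ) (β : V → ℝ) :
    nuDens W (t • η) β = ENNReal.ofReal (Real.exp (t * ∑ i, η i)) *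
      (nuDens W 0 β * ENNReal.ofReal (Real.exp (-(t ^ 2 / 2 * (η ⬝ᵥ (Hmat W β)⁻¹ *ᵥ η))))) := by
  by_cases h : (Hmat W β).PosDef
  · rw [nuDens_of_pd h, nuDens_of_pd h, ← ENNReal.ofReal_mul (by positivity), ← ENNReal.ofReal_mul (by positivity)]
    congr 1
    have h1 : (t • η) ⬝ᵥ (1 : V → ℝ) = t * ∑ i, η i := by
      rw [smul_dotProduct, smul_eq_mul]; simp [dotProduct]
    rw [h1, mulVec_smul, smul_dotProduct, dotProduct_smul, zero_dotProduct, zero_dotProduct, smul_eq_mul, smul_eq_mul]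
    generalize η ⬝ᵥ (Hmat W β)⁻¹ *ᵥ η = q
    generalize (1 : V → ℝ) ⬝ᵥ Hmat W β *ᵥ 1 = p
    rw [show -(1 / 2) * (p + t * (t * q)) + t * ∑ i, η i = t * ∑ i, η i + (-(1 / 2) * (p + 0) + 0) + -(t ^ 2 / 2 * q) by ring,
      Real.exp_add, Real.exp_add]
    ring
  · rw [nuDens_of_not_pd h, nuDens_of_not_pd h]; simp

theorem kern_split (B γ : ℝ) : kern B γ = ENNReal.ofReal (Real.exp B) *
    (ENNReal.ofReal (if 0 < γ then Real.exp (-γ) / Real.sqrt (Real.pi * γ) else 0) *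
      ENNReal.ofReal (Real.exp (-(B ^ 2 / (4 * γ))))) := by
  unfold kern
  split_ifs with h
  · rw [← ENNReal.ofReal_mul (by positivity), ← ENNReal.ofReal_mul (by positivity)]
    congr 1
    rw [show -γ - B ^ 2 / (4 * γ) + B = B + -γ + -(B ^ 2 / (4 * γ)) by ring, Real.exp_add, Real.exp_add]
    ring
  · simp

theorem eq_of_exp_mul {B : ℝ} {x : ENNReal} (h : ENNReal.ofReal (Real.exp B) * x = 1) :
    x = ENNReal.ofReal (Real.exp (-B)) := by
  have : ENNReal.ofReal (Real.exp (-B)) * (ENNReal.ofReal (Real.exp B) * x) = x := by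
    rw [← mul_assoc, ← ENNReal.ofReal_mul (by positivity), ← Real.exp_add]; simp
  rw [h, mul_one] at this
  exact this.symm

theorem stmt14 {V : Type*} [Fintype V] [DecidableEq V] [Nonempty V]
    (W : Matrix V V ℝ) (hsymm : W.IsSymm) (hnn : ∀ i j, 0 ≤ W i j)
    (hdiag : ∀ i, W i i = 0) (hconn : (graphOf W).Connected)
    (η : V → ℝ) (hη : ∀ i, 0 ≤ η i) :
    Measure.map (fun β : V → ℝ => η ⬝ᵥ (Hmat W β)⁻¹.mulVec η) (nuMeas W 0)
      = Measure.map (fun γ : ℝ => (∑ i, η i) ^ 2 / (2 * γ))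
          (volume.withDensity fun γ : ℝ =>
            ENNReal.ofReal (if 0 < γ then Real.exp (-γ) / Real.sqrt (Real.pi * γ) else 0)) := by
  have hdm : Measurable (nuDens W 0) := nuDens_meas W hsymm 0
  have hgm : Measurable fun γ : ℝ =>
      ENNReal.ofReal (if 0 < γ then Real.exp (-γ) / Real.sqrt (Real.pi * γ) else 0) :=
    (Measurable.ite measurableSet_Ioi (by fun_prop) (by fun_prop)).ennreal_ofReal
  have hq := meas_quad W η
  have hc : 0 ≤ ∑ i, η i := Finset.sum_nonneg fun i _ => hη i
  have hL : ∀ n : ℕ, ∫⁻ β, ENNReal.ofReal (Real.exp (-(n * (η ⬝ᵥ (Hmat W β)⁻¹ *ᵥ η)))) ∂(nuMeas W 0)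
      = ENNReal.ofReal (Real.exp (-(√(2 * n) * ∑ i, η i))) := by
    intro n
    have h1 := normOne_all V W hsymm hnn (√(2 * n) • η) (fun i => mul_nonneg (Real.sqrt_nonneg _) (hη i))
    simp_rw [nuDens_smul, Real.sq_sqrt (show (0:ℝ) ≤ 2 * n by positivity), mul_div_cancel_left₀ (n : ℝ) (two_ne_zero)] at h1
    rw [lintegral_const_mul _ (by fun_prop)] at h1
    rw [nuMeas, lintegral_withDensity_eq_lintegral_mul _ hdm (by fun_prop)]
    exact eq_of_exp_mul h1
  have hR : ∀ n : ℕ, ∫⁻ γ, ENNReal.ofReal (Real.exp (-(n * ((∑ i, η i) ^ 2 / (2 * γ))))) ∂(volume.withDensity fun γ : ℝ =>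
            ENNReal.ofReal (if 0 < γ then Real.exp (-γ) / Real.sqrt (Real.pi * γ) else 0))
      = ENNReal.ofReal (Real.exp (-(√(2 * n) * ∑ i, η i))) := by
    intro n
    have h1 := kern_int (√(2 * n) * ∑ i, η i) (by positivity)
    have e : ∀ γ : ℝ, (√(2 * n) * ∑ i, η i) ^ 2 / (4 * γ) = n * ((∑ i, η i) ^ 2 / (2 * γ)) := by
      intro γ
      rw [mul_pow, Real.sq_sqrt (show (0:ℝ) ≤ 2 * n by positivity)]
      by_cases hγ : γ = 0
      · simp [hγ]
      · field_simp; ring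
    simp_rw [kern_split, e] at h1
    rw [lintegral_const_mul' _ _ ENNReal.ofReal_ne_top] at h1
    rw [lintegral_withDensity_eq_lintegral_mul _ hgm (by fun_prop)]
    exact eq_of_exp_mul h1
  have : IsFiniteMeasure (nuMeas W 0) := ⟨by
    have := hL 0
    simp at this
    simp [this]⟩
  have : IsFiniteMeasure (volume.withDensity fun γ : ℝ =>
      ENNReal.ofReal (if 0 < γ then Real.exp (-γ) / Real.sqrt (Real.pi * γ) else 0)) := by
    refine ⟨?_⟩
    have := hR 0
    simp only [Nat.cast_zero, zero_mul, neg_zero, Real.exp_zero, ENNReal.ofReal_one, lintegral_one, mul_zero,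
      Real.sqrt_zero] at this
    rw [this]; exact ENNReal.one_lt_top
  apply ext_laplace _ _ _ _ hq (by fun_prop)
  · rw [nuMeas, ae_withDensity_iff hdm]
    refine Filter.Eventually.of_forall fun β hβ => ?_
    have hpd : (Hmat W β).PosDef := by
      by_contra h
      exact hβ (nuDens_of_not_pd h 0)
    simpa using hpd.inv.posSemidef.dotProduct_mulVec_nonneg η
  · rw [ae_withDensity_iff hgm]
    refine Filter.Eventually.of_forall fun γ hγ => ?_
    have : 0 < γ := by
      by_contra h
      simp [h] at hγ
    positivity
  · intro n
    rw [hL, hR]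

end
end
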